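/- arXiv:2104.06741 — 2 statements merged into one kernel-verified Lean document; each statement's English description precedes it below -/
import Mathlib

section
/- Fix a prime p, natural numbers n, m ≥ 1, and polynomials f_1,…,f_n, g_1,…,g_n ∈ ℤ[x_1,…,x_m]. Let (K, v) be ANY algebraically closed field K of characteristic p together with a nontrivial valuation v : K → Γ₀. Then the following are equivalent: (1) there exists x ∈ (ℤ^ab/pℤ^ab)^m with f_i(x) = 0 and g_i(x) ≠ 0 for all 1 ≤ i ≤ n; (2) there exist m-tuples x_1,…,x_n with all entries in the valuation ring 𝒪_v such that v(f_i(x_j)) < v(g_k(x_k)) for all 1 ≤ i, j, k ≤ n. -/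
noncomputable section

/-- The ring of abelian algebraic integers `ℤ^ab`: the subring of a fixed algebraic
closure of `ℚ` generated by all roots of unity. -/
noncomputable def Zab : Subring (AlgebraicClosure ℚ) :=
  Subring.closure {x : AlgebraicClosure ℚ | ∃ n : ℕ, 0 < n ∧ x ^ n = 1}

/-- The quotient `ℤ^ab / p ℤ^ab`. -/
noncomputable abbrev ZabMod (p : ℕ) : Type :=
  Zab ⧸ Ideal.span {(p : Zab)}

open Polynomial in
lemma mem_adjoin_of_isIntegral {Ω : Type*} [Field Ω] [CharZero Ω]
    [Algebra.IsAlgebraic ℚ Ω] {N : ℕ} (hN : 0 < N) {ζ : Ω}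
    (hζ : IsPrimitiveRoot ζ N) (w : Ω) (hw : IsIntegral ℤ w)
    (hw' : w ∈ IntermediateField.adjoin ℚ {ζ}) : ∃ u : ℤ[X], aeval ζ u = w := by
  have : NeZero N := ⟨hN.ne'⟩
  let L := IntermediateField.adjoin ℚ {ζ}
  have hmem : ζ ∈ L := IntermediateField.mem_adjoin_simple_self ℚ ζ
  have : IsCyclotomicExtension {N} ℚ L := by
    convert! hζ.intermediateField_adjoin_isCyclotomicExtension ℚ
  have hζ' : IsPrimitiveRoot (⟨ζ, hmem⟩ : L) N :=
    IsPrimitiveRoot.of_map_of_injective (f := L.val) (by simpa using hζ) L.val.injective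
  have hIntegral := IsCyclotomicExtension.Rat.isIntegralClosure_adjoin_singleton hζ'
  have hwL : IsIntegral ℤ (⟨w, hw'⟩ : L) := by
    refine (isIntegral_algHom_iff ((L.val : L →+* Ω).toIntAlgHom) L.val.injective).1 ?_
    simpa using hw
  obtain ⟨y, hy⟩ := hIntegral.isIntegral_iff.1 hwL
  have hy2 : (y : L) ∈ (aeval (⟨ζ, hmem⟩ : L) : ℤ[X] →ₐ[ℤ] L).range :=
    (Algebra.adjoin_singleton_eq_range_aeval ℤ (⟨ζ, hmem⟩ : L)).le y.2
  obtain ⟨u, hu⟩ := hy2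
  refine ⟨u, ?_⟩
  have h1 : aeval (⟨ζ, hmem⟩ : L) u = (⟨w, hw'⟩ : L) := by
    rw [← hy]; exact hu
  have h2 := congrArg ((L.val : L →+* Ω).toIntAlgHom) h1
  rw [← aeval_algHom_apply] at h2
  simpa using h2

/-- Generic version of `Zab`. -/
def ZabG (Ω : Type*) [Field Ω] : Subring Ω :=
  Subring.closure {x : Ω | ∃ n : ℕ, 0 < n ∧ x ^ n = 1}

lemma ZabG_isIntegral {Ω : Type*} [Field Ω] (w : Ω) (hw : w ∈ ZabG Ω) : IsIntegral ℤ w := by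
  have : ZabG Ω ≤ (integralClosure ℤ (Ω)).toSubring := by
    refine Subring.closure_le.2 ?_
    rintro x ⟨n, hn, hx⟩
    exact IsIntegral.of_pow hn (by rw [hx]; exact isIntegral_one)
  exact this hw

open Polynomial in
lemma zmod_map_eq_zero {p : ℕ} (r : ℤ[X]) (h : r.map (Int.castRingHom (ZMod p)) = 0) :
    ∃ s : ℤ[X], r = C (p : ℤ) * s := by
  have : C (p : ℤ) ∣ r := by
    rw [C_dvd_iff_dvd_coeff]
    intro i
    have := congrArg (fun q => coeff q i) h
    simpa [ZMod.intCast_zmod_eq_zero_iff_dvd, ZMod.intCast_cast] using this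
  exact this

open Polynomial in
lemma zab_ker {Ω : Type*} [Field Ω] [CharZero Ω]
    [Algebra.IsAlgebraic ℚ Ω] {p : ℕ} [Fact p.Prime] {N : ℕ} (hN : 0 < N) {ζ : Ω}
    (hζ : IsPrimitiveRoot ζ N) (hm : ζ ∈ ZabG Ω) (h : ℤ[X]) :
    (aeval (⟨ζ, hm⟩ : ZabG Ω) h ∈ Ideal.span {(p : ZabG Ω)}) ↔
      cyclotomic N (ZMod p) ∣ h.map (Int.castRingHom (ZMod p)) := by
  have hval : ∀ u : ℤ[X], ((aeval (⟨ζ, hm⟩ : ZabG Ω) u : ZabG Ω) : Ω) = aeval ζ u := by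
    intro u
    exact (aeval_algebraMap_apply Ω (⟨ζ, hm⟩ : ZabG Ω) u).symm
  have hp0 : ((p : ℕ) : Ω) ≠ 0 := by
    exact_mod_cast (Fact.out : p.Prime).ne_zero
  have hmin : minpoly ℤ ζ = cyclotomic N ℤ := (cyclotomic_eq_minpoly hζ hN).symm
  constructor
  · intro hh
    obtain ⟨w, hw⟩ := Ideal.mem_span_singleton'.1 hh
    have hw1 : (w : Ω) * p = aeval ζ h := by
      rw [← hval, ← hw]; simp
    have hwL : (w : Ω) ∈ IntermediateField.adjoin ℚ {ζ} := by
      have : (w : Ω) = aeval ζ (h.map (Int.castRingHom ℚ)) * ((p : ℚ)⁻¹ • 1) := by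
        rw [Algebra.smul_def]
        have : aeval ζ (h.map (Int.castRingHom ℚ)) = aeval ζ h := by
          simpa using (aeval_map_algebraMap (A := ℚ) ζ h)
        rw [this, ← hw1]
        simp [hp0]
      rw [this]
      refine mul_mem ?_ (IntermediateField.smul_mem _ (one_mem _))
      rw [aeval_eq_sum_range]
      exact sum_mem fun i _ => IntermediateField.smul_mem _
        (pow_mem (IntermediateField.mem_adjoin_simple_self ℚ ζ) i)
    obtain ⟨u, hu⟩ := mem_adjoin_of_isIntegral hN hζ w (ZabG_isIntegral (w : Ω) w.2) hwL
    have hz : aeval ζ (h - C (p : ℤ) * u) = 0 := by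
      rw [map_sub, map_mul, hu, ← hw1]; simp [mul_comm]
    have hd := minpoly.isIntegrallyClosed_dvd (hζ.isIntegral hN) hz
    rw [hmin] at hd
    have := Polynomial.map_dvd (Int.castRingHom (ZMod p)) hd
    simpa using this
  · rintro ⟨q, hq⟩
    obtain ⟨q', rfl⟩ := Polynomial.map_surjective (Int.castRingHom (ZMod p))
      (ZMod.ringHom_surjective _) q
    obtain ⟨s, hs⟩ := zmod_map_eq_zero (p := p) (h - cyclotomic N ℤ * q') (by
      simp [hq])
    have hz : aeval (⟨ζ, hm⟩ : ZabG Ω) (cyclotomic N ℤ) = 0 := by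
      apply Subtype.ext
      rw [hval, ← hmin, minpoly.aeval]; rfl
    have : h = cyclotomic N ℤ * q' + C (p : ℤ) * s := by rw [← hs]; ring
    rw [this, map_add, map_mul, map_mul, hz, zero_mul, zero_add]
    refine Ideal.mul_mem_right _ _ ?_
    simp

open Polynomial in
lemma zab_exists_poly {Ω : Type*} [Field Ω] (x : Ω) (hx : x ∈ ZabG Ω) :
    ∃ N : ℕ, 0 < N ∧ ∀ M : ℕ, 0 < M → N ∣ M → ∀ ζ : Ω, IsPrimitiveRoot ζ M →
      ∃ h : ℤ[X], aeval ζ h = x := by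
  induction hx using Subring.closure_induction with
  | mem x hx =>
    obtain ⟨n, hn, hx⟩ := hx
    refine ⟨n, hn, fun M hM hd ζ hζ => ?_⟩
    have : NeZero M := ⟨hM.ne'⟩
    obtain ⟨k, rfl⟩ := hd
    obtain ⟨i, -, hi⟩ := hζ.eq_pow_of_pow_eq_one (ξ := x) (by rw [pow_mul, hx, one_pow])
    exact ⟨X ^ i, by simp [hi]⟩
  | zero => exact ⟨1, one_pos, fun M _ _ ζ _ => ⟨0, by simp⟩⟩
  | one => exact ⟨1, one_pos, fun M _ _ ζ _ => ⟨1, by simp⟩⟩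
  | add x y _ _ hx hy =>
    obtain ⟨N, hN, hx⟩ := hx
    obtain ⟨N', hN', hy⟩ := hy
    refine ⟨N * N', Nat.mul_pos hN hN', fun M hM hd ζ hζ => ?_⟩
    obtain ⟨a, ha⟩ := hx M hM ((dvd_mul_right _ _).trans hd) ζ hζ
    obtain ⟨b, hb⟩ := hy M hM ((dvd_mul_left _ _).trans hd) ζ hζ
    exact ⟨a + b, by simp [ha, hb]⟩
  | neg x _ hx =>
    obtain ⟨N, hN, hx⟩ := hx
    refine ⟨N, hN, fun M hM hd ζ hζ => ?_⟩
    obtain ⟨a, ha⟩ := hx M hM hd ζ hζ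
    exact ⟨-a, by simp [ha]⟩
  | mul x y _ _ hx hy =>
    obtain ⟨N, hN, hx⟩ := hx
    obtain ⟨N', hN', hy⟩ := hy
    refine ⟨N * N', Nat.mul_pos hN hN', fun M hM hd ζ hζ => ?_⟩
    obtain ⟨a, ha⟩ := hx M hM ((dvd_mul_right _ _).trans hd) ζ hζ
    obtain ⟨b, hb⟩ := hy M hM ((dvd_mul_left _ _).trans hd) ζ hζ
    exact ⟨a * b, by simp [ha, hb]⟩

lemma aeval_ringHom_comp {σ A B : Type*} [CommRing A] [CommRing B]
    [Algebra ℤ A] [Algebra ℤ B] (θ : A →+* B) (x : σ → A)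
    (f : MvPolynomial σ ℤ) :
    MvPolynomial.aeval (fun l => θ (x l)) f = θ (MvPolynomial.aeval x f) := by
  induction f using MvPolynomial.induction_on with
  | C a => simp
  | add p q hp hq => rw [map_add, map_add, map_add, hp, hq]
  | mul_X p i hp => rw [map_mul, map_mul, map_mul, hp]; simp

open Polynomial in
/-- Reformulation of solvability in `ℤ^ab/p` in terms of polynomials over `𝔽_p`. -/
lemma zabMod_iff (Ω : Type*) [Field Ω] [CharZero Ω]
    [Algebra.IsAlgebraic ℚ Ω] [IsAlgClosed Ω] (p : ℕ) [Fact p.Prime] (n m : ℕ) (f g : Fin n → MvPolynomial (Fin m) ℤ) :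
    (∃ x : Fin m → (ZabG Ω ⧸ Ideal.span {(p : ZabG Ω)}), ∀ i : Fin n,
        MvPolynomial.aeval x (f i) = 0 ∧ MvPolynomial.aeval x (g i) ≠ 0) ↔
    ∃ N : ℕ, 0 < N ∧ ∃ h : Fin m → (ZMod p)[X], ∀ i : Fin n,
      cyclotomic N (ZMod p) ∣ MvPolynomial.aeval h (f i) ∧
      ¬ cyclotomic N (ZMod p) ∣ MvPolynomial.aeval h (g i) := by
  have key : ∀ (N : ℕ) (hN : 0 < N) (ζ : Ω) (hζ : IsPrimitiveRoot ζ N)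
      (hm : ζ ∈ ZabG Ω) (H : Fin m → ℤ[X]) (F : MvPolynomial (Fin m) ℤ),
      MvPolynomial.aeval (fun l => (Ideal.Quotient.mk (Ideal.span {(p : ZabG Ω)}))
        (aeval (⟨ζ, hm⟩ : ZabG Ω) (H l))) F = 0 ↔
      cyclotomic N (ZMod p) ∣
        MvPolynomial.aeval (fun l => (H l).map (Int.castRingHom (ZMod p))) F := by
    intro N hN ζ hζ hm H F
    have h1 := aeval_ringHom_comp ((Ideal.Quotient.mk (Ideal.span {(p : ZabG Ω)})).comp
      ((aeval (⟨ζ, hm⟩ : ZabG Ω)).toRingHom : ℤ[X] →+* ZabG Ω)) H F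
    have h2 := aeval_ringHom_comp (mapRingHom (Int.castRingHom (ZMod p))) H F
    simp only [RingHom.coe_comp, Function.comp, AlgHom.toRingHom_eq_coe, RingHom.coe_coe,
      coe_mapRingHom] at h1 h2
    rw [h1, h2, Ideal.Quotient.eq_zero_iff_mem, zab_ker hN hζ hm]
  have hroot : ∀ N : ℕ, 0 < N → ∃ ζ : Ω, IsPrimitiveRoot ζ N ∧ ζ ∈ ZabG Ω := by
    intro N hN
    have : NeZero (N : Ω) := ⟨by exact_mod_cast hN.ne'⟩
    obtain ⟨ζ, hζ⟩ := HasEnoughRootsOfUnity.exists_primitiveRoot (Ω) N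
    exact ⟨ζ, hζ, Subring.subset_closure ⟨N, hN, hζ.pow_eq_one⟩⟩
  constructor
  · rintro ⟨x, hx⟩
    choose y hy using fun l => Ideal.Quotient.mk_surjective (x l)
    choose N hN hh using fun l => zab_exists_poly (y l : Ω) (y l).2
    have hpos : 0 < ∏ l, N l := Finset.prod_pos fun l _ => hN l
    obtain ⟨ζ, hζ, hm⟩ := hroot _ hpos
    choose H hH using fun l => hh l _ hpos (Finset.dvd_prod_of_mem N (Finset.mem_univ l)) ζ hζ
    have hxy : x = fun l => (Ideal.Quotient.mk (Ideal.span {(p : ZabG Ω)}))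
        (aeval (⟨ζ, hm⟩ : ZabG Ω) (H l)) := by
      funext l
      rw [← hy l]
      congr 1
      apply Subtype.ext
      rw [← hH l]
      exact aeval_algebraMap_apply Ω (⟨ζ, hm⟩ : ZabG Ω) (H l)
    refine ⟨_, hpos, fun l => (H l).map (Int.castRingHom (ZMod p)), fun i => ?_⟩
    rw [← key _ hpos ζ hζ hm, ← key _ hpos ζ hζ hm, ← hxy]
    exact hx i
  · rintro ⟨N, hN, h, hh⟩
    obtain ⟨ζ, hζ, hm⟩ := hroot _ hN
    choose H hH using fun l => Polynomial.map_surjective (Int.castRingHom (ZMod p))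
      (ZMod.ringHom_surjective _) (h l)
    obtain rfl : (fun l => (H l).map (Int.castRingHom (ZMod p))) = h := funext hH
    refine ⟨_, fun i => ⟨(key _ hN ζ hζ hm H _).2 (hh i).1, fun h0 => (hh i).2 ?_⟩⟩
    exact (key _ hN ζ hζ hm H _).1 h0

lemma zabMod_iff' (p : ℕ) [Fact p.Prime] (n m : ℕ) (f g : Fin n → MvPolynomial (Fin m) ℤ) : 
    (∃ x : Fin m → ZabMod p, ∀ i : Fin n,
        MvPolynomial.aeval x (f i) = 0 ∧ MvPolynomial.aeval x (g i) ≠ 0) ↔ ∃ N : ℕ, 0 < N ∧ ∃ h : Fin m → Polynomial (ZMod p), ∀ i : Fin n,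
      Polynomial.cyclotomic N (ZMod p) ∣ MvPolynomial.aeval h (f i) ∧
      ¬ Polynomial.cyclotomic N (ZMod p) ∣ MvPolynomial.aeval h (g i) := by
  have : Algebra.IsAlgebraic ℚ (AlgebraicClosure ℚ) := by
    convert! AlgebraicClosure.isAlgebraic ℚ
  rw [← zabMod_iff (AlgebraicClosure ℚ)]
  unfold ZabMod Zab ZabG
  constructor
  · rintro ⟨x, hx⟩
    refine ⟨x, fun i => ?_⟩
    convert! hx i
  · rintro ⟨x, hx⟩
    refine ⟨x, fun i => ?_⟩
    convert! hx i

lemma isAlgebraic_zmod_pow_eq_one {p : ℕ} [Fact p.Prime] {k : Type*} [Field k] [Algebra (ZMod p) k]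
    [Algebra.IsAlgebraic (ZMod p) k] (c : k) (hc : c ≠ 0) : ∃ N : ℕ, 0 < N ∧ c ^ N = 1 := by
  let E := IntermediateField.adjoin (ZMod p) {c}
  have hfd : FiniteDimensional (ZMod p) E :=
    IntermediateField.adjoin.finiteDimensional (Algebra.IsIntegral.isIntegral c)
  have hfin : Finite E := Module.finite_of_finite (ZMod p)
  have := Fintype.ofFinite E
  have hmem : c ∈ E := IntermediateField.mem_adjoin_simple_self _ c
  refine ⟨Fintype.card E - 1, ?_, ?_⟩
  · have := Fintype.one_lt_card (α := E)
    omega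
  · have h1 : (⟨c, hmem⟩ : E) ≠ 0 := fun h => hc (congrArg Subtype.val h)
    exact congrArg Subtype.val (FiniteField.pow_card_sub_one_eq_one _ h1)

lemma val_eq_one_of_pow {K Γ₀ : Type*} [Field K] [LinearOrderedCommGroupWithZero Γ₀]
    (v : Valuation K Γ₀) (x : K) (N : ℕ) (hN : 0 < N) (h : x ^ N = 1) : v x = 1 := by
  have h1 : v x ^ N = 1 := by rw [← map_pow, h, map_one]
  rcases lt_trichotomy (v x) 1 with h2 | h2 | h2
  · exact absurd h1 (pow_lt_one₀ zero_le h2 hN.ne').ne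
  · exact h2
  · exact absurd h1 (one_lt_pow₀ h2 hN.ne').ne'

open Polynomial in
lemma exists_primitive_not_dvd {k : Type*} [Field k] [IsAlgClosed k] (N : ℕ) [NeZero (N : k)]
    (G : k[X]) (φ : ℕ) (h : ¬ cyclotomic N k ^ φ ∣ G) :
    ∃ ω : k, (X - C ω) ∣ cyclotomic N k ∧ ¬ (X - C ω) ^ φ ∣ G := by
  by_contra! hcon
  apply h
  obtain ⟨ζ, hζ⟩ := HasEnoughRootsOfUnity.exists_primitiveRoot k N
  rw [cyclotomic_eq_prod_X_sub_primitiveRoots hζ, ← Finset.prod_pow]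
  refine Finset.prod_dvd_of_coprime ?_ ?_
  · intro a _ b _ hab
    exact (pairwise_coprime_X_sub_C (Function.injective_id) hab).pow
  · intro ω hω
    apply hcon
    rw [cyclotomic_eq_prod_X_sub_primitiveRoots hζ]
    exact Finset.dvd_prod_of_mem _ hω

open Polynomial in
lemma cyclotomic_charP_form (p : ℕ) [Fact p.Prime] (N : ℕ) (hN : 0 < N) :
    ∃ N' φ : ℕ, ¬ p ∣ N' ∧ 0 < φ ∧ ∀ (R : Type) [Field R] [CharP R p],
      cyclotomic N R = cyclotomic N' R ^ φ := by
  obtain ⟨e, N', hN', rfl⟩ := Nat.exists_eq_pow_mul_and_not_dvd hN.ne' p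
    (Fact.out : p.Prime).ne_one
  rcases Nat.eq_zero_or_pos e with rfl | he
  · exact ⟨N', 1, hN', one_pos, fun R _ _ => by simp⟩
  · refine ⟨N', p ^ e - p ^ (e - 1), hN', ?_, fun R _ _ => cyclotomic_mul_prime_pow_eq R hN' he⟩
    have := Nat.pow_lt_pow_right (Fact.out : p.Prime).one_lt (show e - 1 < e by omega)
    omega

open Polynomial in
lemma partB (p : ℕ) [Fact p.Prime] (n m : ℕ)
    (f g : Fin n → MvPolynomial (Fin m) ℤ)
    (K : Type*) [Field K] (k : Type*) [Field k] [Algebra k K] [IsAlgClosed k]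
    [Algebra (ZMod p) k] [Algebra.IsAlgebraic (ZMod p) k]
    (Γ₀ : Type*) [LinearOrderedCommGroupWithZero Γ₀]
    (v : Valuation K Γ₀) (τ : K) (hτ0 : τ ≠ 0) (hτ : v τ < 1)
    (H : ∃ N : ℕ, 0 < N ∧ ∃ h : Fin m → (ZMod p)[X], ∀ i : Fin n,
      cyclotomic N (ZMod p) ∣ MvPolynomial.aeval h (f i) ∧
      ¬ cyclotomic N (ZMod p) ∣ MvPolynomial.aeval h (g i)) :
    (∃ x : Fin n → Fin m → K, (∀ j l, v (x j l) ≤ 1) ∧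
        ∀ i j k : Fin n,
          v (MvPolynomial.aeval (x j) (f i)) < v (MvPolynomial.aeval (x k) (g k))) := by
  obtain ⟨N, hN, h, hh⟩ := H
  obtain ⟨N', φ, hN', hφ, hcyc⟩ := cyclotomic_charP_form p N hN
  have hcharp : CharP k p := charP_of_injective_algebraMap (algebraMap (ZMod p) k).injective p
  have hne : NeZero (N' : k) := ⟨by rwa [Ne, CharP.cast_eq_zero_iff k p]⟩
  have hvk : ∀ c : k, c ≠ 0 → v (algebraMap k K c) = 1 := by
    intro c hc
    obtain ⟨M, hM, hM'⟩ := isAlgebraic_zmod_pow_eq_one (p := p) c hc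
    exact val_eq_one_of_pow v _ M hM (by rw [← map_pow, hM', map_one])
  have hvk' : ∀ c : k, v (algebraMap k K c) ≤ 1 := by
    intro c
    by_cases hc : c = 0
    · simp [hc]
    · exact (hvk c hc).le
  have hvpoly : ∀ (y : K) (_ : v y ≤ 1) (q : k[X]), v (aeval y q) ≤ 1 := by
    intro y hy q
    rw [aeval_eq_sum_range]
    refine v.map_sum_le fun i _ => ?_
    rw [Algebra.smul_def, map_mul, map_pow]
    exact mul_le_one' (hvk' _) (pow_le_one' hy _)
  let ι := mapRingHom (algebraMap (ZMod p) k)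
  have hcycmap : ι (cyclotomic N (ZMod p)) = cyclotomic N' k ^ φ := by
    rw [hcyc, map_pow]; simp [ι]
  have hω : ∀ i : Fin n, ∃ ω : k, (X - C ω) ∣ cyclotomic N' k ∧
      ¬ (X - C ω) ^ φ ∣ ι (MvPolynomial.aeval h (g i)) := by
    intro i
    refine exists_primitive_not_dvd N' _ φ ?_
    rw [← hcycmap]
    intro hd
    exact (hh i).2 ((Polynomial.map_dvd_map' _).1 hd)
  choose ω hω1 hω2 using hω
  let y : Fin n → K := fun j => algebraMap k K (ω j) + τ
  have hy : ∀ j, v (y j) ≤ 1 := fun j => v.map_add_le (hvk' _) hτ.le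
  have hyX : ∀ j, aeval (y j) (X - C (ω j)) = τ := fun j => by simp [y]
  have hx : ∀ (j : Fin n) (F : MvPolynomial (Fin m) ℤ),
      MvPolynomial.aeval (fun l => aeval (y j) (ι (h l))) F =
        aeval (y j) (ι (MvPolynomial.aeval h F)) := by
    intro j F
    exact aeval_ringHom_comp (((aeval (y j)).toRingHom : k[X] →+* K).comp ι) h F
  refine ⟨fun j l => aeval (y j) (ι (h l)), fun j l => hvpoly _ (hy j) _, fun i j l => ?_⟩
  rw [hx, hx]
  have h1 : v (aeval (y j) (ι (MvPolynomial.aeval h (f i)))) ≤ v τ ^ φ := by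
    obtain ⟨q, hq⟩ : (X - C (ω j)) ^ φ ∣ ι (MvPolynomial.aeval h (f i)) :=
      (pow_dvd_pow_of_dvd (hω1 j) φ).trans (hcycmap ▸ map_dvd ι (hh i).1)
    rw [hq, map_mul, map_pow, hyX, map_mul, map_pow]
    exact mul_le_of_le_one_right' (hvpoly _ (hy j) _)
  refine h1.trans_lt ?_
  set G := ι (MvPolynomial.aeval h (g l)) with hG
  have hG0 : G ≠ 0 := by
    intro h0
    apply hω2 l
    rw [← hG, h0]
    exact dvd_zero _
  obtain ⟨q, hq, hq'⟩ := exists_eq_pow_rootMultiplicity_mul_and_not_dvd G hG0 (ω l)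
  set μ := G.rootMultiplicity (ω l)
  have hμ : μ < φ := by
    by_contra! hle
    exact hω2 l (by rw [← hG, hq]; exact (pow_dvd_pow _ hle).mul_right _)
  have hqv : v (aeval (y l) q) = 1 := by
    obtain ⟨r, hr⟩ := X_sub_C_dvd_sub_C_eval (a := ω l) (p := q)
    have h2 : q = C (q.eval (ω l)) + (X - C (ω l)) * r := by rw [← hr]; ring
    have h3 : q.eval (ω l) ≠ 0 := fun h0 => hq' (dvd_iff_isRoot.2 h0)
    rw [h2, map_add, map_mul, hyX, aeval_C, v.map_add_eq_of_lt_left, hvk _ h3]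
    rw [hvk _ h3, map_mul]
    exact mul_lt_one_of_lt_of_le hτ (hvpoly _ (hy l) _)
  rw [hq, map_mul, map_pow, hyX, map_mul, map_pow, hqv, mul_one]
  exact pow_lt_pow_right_of_lt_one₀ (zero_lt_iff.2 ((v.ne_zero_iff).2 hτ0)) hτ hμ

open Polynomial in
lemma lift_pi {p : ℕ} [Fact p.Prime] {n m : ℕ} (π : (ZMod p)[X]) (hπ : Irreducible π)
    (P : Fin m → (AdjoinRoot π)[X]) (M φ a r : ℕ) (hφ : 0 < φ) (hr : φ ≤ p ^ r)
    (h1 : φ ≤ a * M) (h2 : a * (M - 1) < φ)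
    (f : Fin n → MvPolynomial (Fin m) ℤ) (g : MvPolynomial (Fin m) ℤ)
    (hf : ∀ i, X ^ M ∣ MvPolynomial.aeval P (f i)) (hg : ¬ X ^ M ∣ MvPolynomial.aeval P g) :
    ∃ h : Fin m → (ZMod p)[X], (∀ i, π ^ φ ∣ MvPolynomial.aeval h (f i)) ∧
      ¬ π ^ φ ∣ MvPolynomial.aeval h g := by
  have hprime : Prime π := hπ.prime
  have ha : 0 < a := Nat.pos_of_ne_zero fun h => by subst h; omega
  have hQ0 : p ^ r ≠ 0 := by omega
  let μ := mapRingHom (AdjoinRoot.mk π)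
  choose G hG using fun l => Polynomial.map_surjective (AdjoinRoot.mk π) AdjoinRoot.mk_surjective (P l)
  let Ψ : (ZMod p)[X][X] →+* (ZMod p)[X] :=
    eval₂RingHom (iterateFrobenius (ZMod p)[X] p r) (π ^ a)
  have hΨ : ∀ W, Ψ W = ∑ i ∈ Finset.range (W.natDegree + 1), W.coeff i ^ p ^ r * π ^ (a * i) := by
    intro W
    simp only [Ψ, coe_eval₂RingHom, eval₂_eq_sum_range, iterateFrobenius_def, pow_mul]
  have hP : ∀ F : MvPolynomial (Fin m) ℤ, MvPolynomial.aeval P F = μ (MvPolynomial.aeval G F) := by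
    intro F
    rw [← aeval_ringHom_comp]
    congr 2
    funext l
    exact (hG l).symm
  have hh : ∀ F : MvPolynomial (Fin m) ℤ,
      MvPolynomial.aeval (fun l => Ψ (G l)) F = Ψ (MvPolynomial.aeval G F) := fun F =>
    aeval_ringHom_comp _ _ _
  have hdv : ∀ W, X ^ M ∣ μ W ↔ ∀ i < M, π ∣ W.coeff i := by
    intro W
    simp only [X_pow_dvd_iff, μ, coe_mapRingHom, coeff_map, AdjoinRoot.mk_eq_zero]
  refine ⟨fun l => Ψ (G l), fun i => ?_, ?_⟩
  · rw [hh, hΨ]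
    have h3 := hf i
    rw [hP, hdv] at h3
    refine Finset.dvd_sum fun j _ => ?_
    rcases lt_or_ge j M with hj | hj
    · exact ((pow_dvd_pow _ hr).trans (pow_dvd_pow_of_dvd (h3 j hj) _)).mul_right _
    · exact (pow_dvd_pow _ (h1.trans (Nat.mul_le_mul_left a hj))).mul_left _
  · rw [hP, hdv] at hg
    push Not at hg
    rw [hh]
    set W := MvPolynomial.aeval G g
    classical
    have hex : ∃ i, ¬ π ∣ W.coeff i := let ⟨i, _, hi⟩ := hg; ⟨i, hi⟩
    set s := Nat.find hex with hs
    have hs1 : ¬ π ∣ W.coeff s := Nat.find_spec hex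
    have hs2 : ∀ i < s, π ∣ W.coeff i := fun i hi => by
      have := Nat.find_min hex hi
      push Not at this; exact this
    obtain ⟨i0, hi0, hi0'⟩ := hg
    have hsM : s < M := (Nat.find_min' hex hi0').trans_lt hi0
    have hlt : a * s + 1 ≤ φ := by
      have : a * s ≤ a * (M - 1) := Nat.mul_le_mul_left a (by omega)
      omega
    intro hd
    have hmem : s ∈ Finset.range (W.natDegree + 1) := by
      rw [Finset.mem_range]
      by_contra! hle
      exact hs1 (by rw [coeff_eq_zero_of_natDegree_lt (by omega)]; exact dvd_zero _)
    rw [hΨ, ← Finset.add_sum_erase _ _ hmem] at hd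
    have hrest : π ^ (a * s + 1) ∣
        ∑ i ∈ (Finset.range (W.natDegree + 1)).erase s, W.coeff i ^ p ^ r * π ^ (a * i) := by
      refine Finset.dvd_sum fun j hj => ?_
      rcases lt_or_gt_of_ne (Finset.ne_of_mem_erase hj) with hj | hj
      · exact ((pow_dvd_pow _ (hlt.trans hr)).trans
          (pow_dvd_pow_of_dvd (hs2 j hj) _)).mul_right _
      · refine (pow_dvd_pow _ ?_).mul_left _
        have : a * (s + 1) ≤ a * j := Nat.mul_le_mul_left a hj
        have : a * (s + 1) = a * s + a := by ring
        omega
    have h4 := (dvd_add_left hrest).1 ((pow_dvd_pow _ hlt).trans hd)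
    rw [pow_succ, mul_comm (W.coeff s ^ p ^ r)] at h4
    have h5 := (mul_dvd_mul_iff_left (pow_ne_zero _ hprime.ne_zero)).1 h4
    exact hs1 (hprime.dvd_of_dvd_pow h5)

open Polynomial in
lemma descend_coeffs {p : ℕ} [Fact p.Prime] {n m : ℕ} {k : Type*} [Field k] [Algebra (ZMod p) k]
    [Algebra.IsAlgebraic (ZMod p) k] (P : Fin n → Fin m → k[X]) :
    ∃ d : ℕ, 0 < d ∧ ∀ π : (ZMod p)[X], Irreducible π → d ∣ π.natDegree →
      ∃ P' : Fin n → Fin m → (AdjoinRoot π)[X], ∀ (M : ℕ) (j : Fin n) (F : MvPolynomial (Fin m) ℤ),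
        X ^ M ∣ MvPolynomial.aeval (P' j) F ↔ X ^ M ∣ MvPolynomial.aeval (P j) F := by
  classical
  let T : Finset k := Finset.univ.biUnion fun j : Fin n => Finset.univ.biUnion fun l : Fin m =>
    (P j l).coeffs
  let E := IntermediateField.adjoin (ZMod p) (T : Set k)
  have hfd : FiniteDimensional (ZMod p) E :=
    IntermediateField.finiteDimensional_adjoin fun x _ => Algebra.IsIntegral.isIntegral x
  refine ⟨Module.finrank (ZMod p) E, Module.finrank_pos, fun π hπ hd => ?_⟩
  have hlift : ∀ j l, ∃ Q : E[X], Q.map (algebraMap E k) = P j l := by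
    intro j l
    have : P j l ∈ lifts (algebraMap E k) := by
      rw [lifts_iff_coeff_lifts]
      intro i
      by_cases h0 : (P j l).coeff i = 0
      · exact ⟨0, by simp [h0]⟩
      · have hm : (P j l).coeff i ∈ E := IntermediateField.subset_adjoin _ _ (by
          simp only [T, Finset.coe_biUnion, Set.mem_iUnion]
          exact ⟨j, by simp, l, by simp, coeff_mem_coeffs h0⟩)
        exact ⟨⟨_, hm⟩, rfl⟩
    exact this
  choose Q hQ using hlift
  have : Fact (Irreducible π) := ⟨hπ⟩
  have hfd2 : FiniteDimensional (ZMod p) (AdjoinRoot π) :=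
    (AdjoinRoot.powerBasis hπ.ne_zero).finite
  have : Finite (AdjoinRoot π) := Module.finite_of_finite (ZMod p)
  have hfr : Module.finrank (ZMod p) (AdjoinRoot π) = π.natDegree := by
    rw [(AdjoinRoot.powerBasis hπ.ne_zero).finrank, AdjoinRoot.powerBasis_dim]
  obtain ⟨σ⟩ := FiniteField.nonempty_algHom_of_finrank_dvd (F := ZMod p) (K := E)
    (L := AdjoinRoot π) (by rw [hfr]; exact hd)
  refine ⟨fun j l => mapRingHom (σ : E →+* AdjoinRoot π) (Q j l), fun M j F => ?_⟩
  have e1 := aeval_ringHom_comp (mapRingHom (σ : E →+* AdjoinRoot π)) (Q j) F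
  have e2 := aeval_ringHom_comp (mapRingHom (algebraMap E k)) (Q j) F
  have e3 : P j = fun l => mapRingHom (algebraMap E k) (Q j l) := funext fun l => (hQ j l).symm
  rw [e1, e3, e2]
  generalize MvPolynomial.aeval (Q j) F = W
  simp [X_pow_dvd_iff, coeff_map]

lemma lt_pow_order {p s : ℕ} (hp : 1 < p) (hs : p.Coprime s) (hs0 : 0 < s) :
    s < p ^ orderOf (ZMod.unitOfCoprime p hs) := by
  have : NeZero s := ⟨hs0.ne'⟩
  set j := orderOf (ZMod.unitOfCoprime p hs)
  have hj : 0 < j := orderOf_pos _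
  have h1 : (ZMod.unitOfCoprime p hs) ^ j = 1 := pow_orderOf_eq_one _
  have h2 : ((p ^ j : ℕ) : ZMod s) = (1 : ℕ) := by
    have := congrArg (Units.val) h1
    simpa using this
  have h3 := (ZMod.natCast_eq_natCast_iff _ _ _).1 h2
  have h4 : s ∣ p ^ j - 1 := (Nat.modEq_iff_dvd' (Nat.one_le_pow _ _ (by omega))).1 h3.symm
  have h5 : 1 < p ^ j := Nat.one_lt_pow hj.ne' hp
  have := Nat.le_of_dvd (by omega) h4
  omega

lemma order_le_totient {p s : ℕ} (hs : p.Coprime s) (hs0 : 0 < s) :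
    orderOf (ZMod.unitOfCoprime p hs) ≤ Nat.totient s := by
  have : NeZero s := ⟨hs0.ne'⟩
  rw [← ZMod.card_units_eq_totient]
  exact orderOf_le_card_univ

open Polynomial UniqueFactorizationMonoid in
lemma exists_many_factors (p : ℕ) [Fact p.Prime] (n d : ℕ) (hn : 0 < n) (hd : 0 < d) :
    ∃ N : ℕ, 0 < N ∧ ¬ p ∣ N ∧
      n ≤ (normalizedFactors (cyclotomic N (ZMod p))).toFinset.card ∧
      ∀ π ∈ normalizedFactors (cyclotomic N (ZMod p)), d ∣ π.natDegree := by
  have hp : p.Prime := Fact.out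
  have hp1 := hp.one_lt
  set D := 2 * n * d with hD
  have hD0 : 0 < D := by positivity
  have hpD : 1 < p ^ D := Nat.one_lt_pow hD0.ne' hp1
  have hdvd : p ∣ p ^ D := dvd_pow_self p hD0.ne'
  set N := (p ^ D - 1) * (p ^ D + 1) with hN
  have hN1 : N = p ^ (2 * D) - 1 := by
    rw [hN, two_mul, pow_add]
    obtain ⟨t, ht⟩ := Nat.exists_eq_add_of_lt hpD
    rw [ht]
    have : (1 + t + 1) * (1 + t + 1) = (1 + t + 1 - 1) * (1 + t + 1 + 1) + 1 := by
      simp; ring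
    omega
  have hc1 : p.Coprime (p ^ D - 1) := by
    rw [hp.coprime_iff_not_dvd]
    intro h
    have := (Nat.dvd_sub hdvd h)
    rw [show p ^ D - (p ^ D - 1) = 1 by omega] at this
    exact hp.one_lt.ne' (Nat.dvd_one.1 this)
  have hc2 : p.Coprime (p ^ D + 1) := by
    rw [hp.coprime_iff_not_dvd]
    intro h
    exact hp.one_lt.ne' (Nat.dvd_one.1 ((Nat.dvd_add_right hdvd).1 h))
  have hc : p.Coprime N := Nat.Coprime.mul_right hc1 hc2
  have hN0 : 0 < N := Nat.mul_pos (by omega) (by omega)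
  have h1 : D ≤ Nat.totient (p ^ D - 1) := by
    refine le_trans ?_ (order_le_totient hc1 (by omega))
    have := lt_pow_order hp1 hc1 (by omega)
    exact (Nat.pow_le_pow_iff_right hp1).1 (by omega)
  have h2 : D ≤ Nat.totient (p ^ D + 1) := by
    refine le_trans ?_ (order_le_totient hc2 (by omega))
    have := lt_pow_order hp1 hc2 (by omega)
    exact (Nat.pow_le_pow_iff_right hp1).1 (by omega)
  have h3 : D * D ≤ Nat.totient N :=
    (Nat.mul_le_mul h1 h2).trans (Nat.totient_super_multiplicative _ _)
  have hord : orderOf (ZMod.unitOfCoprime p hc) = 2 * D := by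
    have hdv : orderOf (ZMod.unitOfCoprime p hc) ∣ 2 * D := by
      apply orderOf_dvd_of_pow_eq_one
      ext
      push_cast
      rw [ZMod.coe_unitOfCoprime]
      have : ((p ^ (2 * D) : ℕ) : ZMod N) = (1 : ℕ) := by
        rw [ZMod.natCast_eq_natCast_iff]
        refine ((Nat.modEq_iff_dvd' (Nat.one_le_pow _ _ (by omega))).2 ?_).symm
        rw [← hN1]
      simpa using this
    have hle : 2 * D ≤ orderOf (ZMod.unitOfCoprime p hc) := by
      have := lt_pow_order hp1 hc hN0
      have h5 : 0 < p ^ (2 * D) := by positivity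
      exact (Nat.pow_le_pow_iff_right hp1).1 (by omega)
    exact le_antisymm (Nat.le_of_dvd (by omega) hdv) hle
  have hK : Fintype.card (ZMod p) = p ^ 1 := by simp [ZMod.card]
  have hu : (ZMod.unitOfCoprime (p ^ 1) (hc.pow_left 1)) = ZMod.unitOfCoprime p hc := by
    ext; simp
  refine ⟨N, hN0, hp.coprime_iff_not_dvd.1 hc, ?_, fun π hπ => ?_⟩
  · rw [normalizedFactors_cyclotomic_card hK hc, hu, hord]
    rw [Nat.le_div_iff_mul_le (by omega)]
    refine le_trans ?_ h3
    have : n * (2 * D) = (2 * n) * D := by ring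
    rw [this]
    refine Nat.mul_le_mul_right _ ?_
    rw [hD]
    exact Nat.le_mul_of_pos_right _ hd
  · rw [natDegree_of_mem_normalizedFactors_cyclotomic hK hc hπ, hu, hord, hD]
    exact ((dvd_mul_left d _).mul_left 2)

open Polynomial UniqueFactorizationMonoid in
lemma partC (p : ℕ) [Fact p.Prime] (n m : ℕ) (hn : 0 < n)
    (f g : Fin n → MvPolynomial (Fin m) ℤ) (k : Type*) [Field k]
    [Algebra (ZMod p) k] [Algebra.IsAlgebraic (ZMod p) k] (P : Fin n → Fin m → k[X]) (M : ℕ)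
    (hf : ∀ i j, X ^ M ∣ MvPolynomial.aeval (P j) (f i))
    (hg : ∀ i, ¬ X ^ M ∣ MvPolynomial.aeval (P i) (g i)) :
    ∃ N : ℕ, 0 < N ∧ ∃ h : Fin m → (ZMod p)[X], ∀ i : Fin n,
      cyclotomic N (ZMod p) ∣ MvPolynomial.aeval h (f i) ∧
      ¬ cyclotomic N (ZMod p) ∣ MvPolynomial.aeval h (g i) := by
  classical
  have hp : p.Prime := Fact.out
  obtain ⟨d, hd, hdesc⟩ := descend_coeffs (p := p) P
  obtain ⟨N, hN, hpN, hcard, hdeg⟩ := exists_many_factors p n d hn hd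
  set S := (normalizedFactors (cyclotomic N (ZMod p))).toFinset with hS
  have hM : 0 < M := Nat.pos_of_ne_zero fun h => hg ⟨0, hn⟩ (by simp [h])
  set e := M ^ 2 + 1 with he
  set φ := p ^ e - p ^ (e - 1) with hφ
  have hφ1 : M ^ 2 < φ := by
    have h1 : M ^ 2 < p ^ (M ^ 2) := Nat.lt_pow_self hp.one_lt
    have h2 : 2 * p ^ (M ^ 2) ≤ p ^ e := by
      rw [he, pow_succ, mul_comm]
      exact Nat.mul_le_mul_left _ hp.two_le
    have h3 : e - 1 = M ^ 2 := by omega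
    rw [hφ, h3]
    omega
  obtain ⟨a, ha1, ha2⟩ : ∃ a, φ ≤ a * M ∧ a * (M - 1) < φ := by
    obtain ⟨c, rfl⟩ : ∃ c, M = c + 1 := ⟨M - 1, by omega⟩
    have h1 := Nat.div_add_mod (φ + c) (c + 1)
    have h2 := Nat.mod_lt (φ + c) (show 0 < c + 1 by omega)
    set a := (φ + c) / (c + 1)
    refine ⟨a, by nlinarith, ?_⟩
    simp only [Nat.add_sub_cancel]
    by_contra! hle
    have h3 : (c + 1) * a ≤ φ + c := by omega
    have h4 : φ * (c + 1) ≤ a * c * (c + 1) := Nat.mul_le_mul_right _ hle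
    have h5 : (c + 1) * a * c ≤ (φ + c) * c := Nat.mul_le_mul_right _ h3
    nlinarith
  have hSirr : ∀ π ∈ S, Irreducible π := fun π hπ =>
    irreducible_of_normalized_factor π (Multiset.mem_toFinset.1 hπ)
  -- a surjection onto the indices
  obtain ⟨ι, hι⟩ : ∃ ι : Fin n → S, Function.Injective ι := by
    have : Fintype.card (Fin n) ≤ Fintype.card S := by simpa using hcard
    obtain ⟨ι⟩ := Function.Embedding.nonempty_of_card_le this
    exact ⟨ι, ι.injective⟩
  have : Nonempty (Fin n) := ⟨⟨0, hn⟩⟩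
  have hloc : ∀ π : S, ∃ h : Fin m → (ZMod p)[X],
      (∀ i, (π : (ZMod p)[X]) ^ φ ∣ MvPolynomial.aeval h (f i)) ∧
      ¬ (π : (ZMod p)[X]) ^ φ ∣ MvPolynomial.aeval h (g (Function.invFun ι π)) := by
    intro π
    obtain ⟨P', hP'⟩ := hdesc π (hSirr π π.2) (hdeg π (Multiset.mem_toFinset.1 π.2))
    refine lift_pi (π : (ZMod p)[X]) (hSirr π π.2) (P' (Function.invFun ι π)) M φ a e (by omega)
      (by omega) ha1 ha2 f _ (fun i => ?_) ?_
    · rw [hP']; exact hf _ _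
    · rw [hP']; exact hg _
  choose H hH1 hH2 using hloc
  have hcrt : ∀ l : Fin m, ∃ y : (ZMod p)[X], ∀ π (hπ : π ∈ S),
      y - H ⟨π, hπ⟩ l ∈ (Ideal.span {π}) ^ φ := by
    intro l
    refine IsDedekindDomain.exists_forall_sub_mem_ideal (s := S)
      (fun π : (ZMod p)[X] => Ideal.span {π}) (fun _ => φ) (fun π hπ => ?_) ?_ (fun π => H π l)
    · exact (Ideal.prime_span_singleton_iff).2 (hSirr π hπ).prime
    · intro π hπ π' hπ' hne heq
      rw [Ideal.span_singleton_eq_span_singleton] at heq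
      apply hne
      have h1 := normalize_normalized_factor π (Multiset.mem_toFinset.1 hπ)
      have h2 := normalize_normalized_factor π' (Multiset.mem_toFinset.1 hπ')
      rw [← h1, ← h2]
      exact normalize_eq_normalize_iff_associated.2 heq
  choose h hh using hcrt
  have hcong : ∀ (π : S) (F : MvPolynomial (Fin m) ℤ),
      (π : (ZMod p)[X]) ^ φ ∣ MvPolynomial.aeval h F ↔
      (π : (ZMod p)[X]) ^ φ ∣ MvPolynomial.aeval (H π) F := by
    intro π F
    let I := Ideal.span {(π : (ZMod p)[X]) ^ φ}
    have e1 := aeval_ringHom_comp (Ideal.Quotient.mk I) h F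
    have e2 := aeval_ringHom_comp (Ideal.Quotient.mk I) (H π) F
    have e3 : (fun l => Ideal.Quotient.mk I (h l)) = fun l => Ideal.Quotient.mk I (H π l) := by
      funext l
      rw [Ideal.Quotient.eq]
      have := hh l π π.2
      rwa [Ideal.span_singleton_pow] at this
    rw [e3, e2] at e1
    rw [← Ideal.mem_span_singleton, ← Ideal.mem_span_singleton, ← Ideal.Quotient.eq_zero_iff_mem,
      ← Ideal.Quotient.eq_zero_iff_mem, e1]
  have hne : NeZero (N : ZMod p) := ⟨by rwa [Ne, CharP.cast_eq_zero_iff (ZMod p) p]⟩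
  have hsq : (normalizedFactors (cyclotomic N (ZMod p))).Nodup :=
    (squarefree_iff_nodup_normalizedFactors (cyclotomic_ne_zero N _)).1
      (separable_cyclotomic N (ZMod p)).squarefree
  have hprod : Associated (∏ π ∈ S, π) (cyclotomic N (ZMod p)) := by
    have h1 := prod_normalizedFactors (cyclotomic_ne_zero N (ZMod p))
    have h2 : ∏ π ∈ S, π = (normalizedFactors (cyclotomic N (ZMod p))).prod := by
      rw [hS, Finset.prod_multiset_count, Finset.prod_congr rfl]
      intro π hπ
      rw [Multiset.count_eq_one_of_mem hsq (Multiset.mem_toFinset.1 hπ), pow_one]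
    rw [h2]; exact h1
  have hcyc : cyclotomic (p ^ e * N) (ZMod p) = cyclotomic N (ZMod p) ^ φ :=
    cyclotomic_mul_prime_pow_eq (ZMod p) hpN (by omega)
  refine ⟨p ^ e * N, Nat.mul_pos (pow_pos hp.pos _) hN, h, fun i => ⟨?_, ?_⟩⟩
  · rw [hcyc, ← (hprod.pow_pow (n := φ)).dvd_iff_dvd_left, ← Finset.prod_pow]
    refine Finset.prod_dvd_of_coprime ?_ ?_
    · intro π hπ π' hπ' hne
      refine IsCoprime.pow ?_
      refine (hSirr π hπ).coprime_iff_not_dvd.2 fun hdv => hne ?_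
      have h0 := (hSirr π hπ).associated_of_dvd (hSirr π' hπ') hdv
      have h1 := normalize_normalized_factor π (Multiset.mem_toFinset.1 hπ)
      have h2 := normalize_normalized_factor π' (Multiset.mem_toFinset.1 hπ')
      rw [← h1, ← h2]
      exact normalize_eq_normalize_iff_associated.2 h0
    · intro π hπ
      exact (hcong ⟨π, hπ⟩ _).2 (hH1 ⟨π, hπ⟩ i)
  · intro hdv
    rw [hcyc] at hdv
    have h1 := hH2 (ι i)
    rw [Function.leftInverse_invFun hι i] at h1
    apply h1
    rw [← hcong]
    refine dvd_trans (pow_dvd_pow_of_dvd ?_ φ) hdv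
    exact dvd_of_mem_normalizedFactors (Multiset.mem_toFinset.1 (ι i).2)

open Polynomial in
lemma ded_pow_notMem {S : Type*} [CommRing S] [IsDedekindDomain S] (𝔫 : Ideal S) [𝔫.IsPrime]
    (h0 : 𝔫 ≠ ⊥) (s : S) (hs1 : s ∈ 𝔫) (hs2 : s ∉ 𝔫 ^ 2) (r : ℕ) : s ^ r ∉ 𝔫 ^ (r + 1) := by
  have hp : Prime 𝔫 := Ideal.prime_of_isPrime h0 inferInstance
  obtain ⟨J, hJ⟩ := (Ideal.dvd_span_singleton).2 hs1
  intro h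
  rw [← Ideal.dvd_span_singleton, ← Ideal.span_singleton_pow, hJ, mul_pow, pow_succ,
    mul_dvd_mul_iff_left (pow_ne_zero _ h0)] at h
  obtain ⟨L, hL⟩ := hp.dvd_of_dvd_pow h
  apply hs2
  rw [← Ideal.dvd_span_singleton, hJ, hL]
  exact ⟨L, by ring⟩

open Polynomial in
lemma partD1 {k S : Type*} [Field k] [CommRing S] [IsDedekindDomain S] [Algebra k S]
    (𝔫 : Ideal S) [𝔫.IsPrime] (h0 : 𝔫 ≠ ⊥) (hres : ∀ x : S, ∃ c : k, x - algebraMap k S c ∈ 𝔫)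
    {n m : ℕ} (f g : Fin n → MvPolynomial (Fin m) ℤ) (y : Fin n → Fin m → S) (b : S) (hb : b ≠ 0)
    (hf : ∀ i j, ∃ c ∈ 𝔫, MvPolynomial.aeval (y j) (f i) = b * c)
    (hg : ∀ i, MvPolynomial.aeval (y i) (g i) ∣ b) :
    ∃ (M : ℕ) (P : Fin n → Fin m → k[X]), (∀ i j, X ^ M ∣ MvPolynomial.aeval (P j) (f i)) ∧
      ∀ i, ¬ X ^ M ∣ MvPolynomial.aeval (P i) (g i) := by
  have hne : 𝔫 ≠ ⊤ := Ideal.IsPrime.ne_top inferInstance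
  obtain ⟨s, hs1, hs2⟩ := Ideal.exists_mem_pow_notMem_pow_succ 𝔫 h0 hne 1
  rw [pow_one] at hs1
  have hsr := ded_pow_notMem 𝔫 h0 s hs1 hs2
  have hC : ∀ c : k, algebraMap k S c ∈ 𝔫 → c = 0 := by
    intro c hc
    by_contra hc0
    exact hne (Ideal.eq_top_of_isUnit_mem _ hc ((isUnit_iff_ne_zero.2 hc0).map _))
  have hI : ∀ (M : ℕ) (x : S), ∃ P : k[X], x - aeval s P ∈ 𝔫 ^ M := by
    intro M
    induction M with
    | zero => intro x; exact ⟨0, by simp⟩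
    | succ M ih =>
      intro x
      obtain ⟨P, hP⟩ := ih x
      obtain ⟨d, e, he, hde⟩ := Ideal.exists_mul_add_mem_pow_succ h0 (s ^ M) _
        (Ideal.pow_mem_pow hs1 M) (hsr M) hP
      obtain ⟨c, hc⟩ := hres d
      refine ⟨P + C c * X ^ M, ?_⟩
      have : x - aeval s (P + C c * X ^ M) = s ^ M * (d - algebraMap k S c) + e := by
        simp only [map_add, map_mul, map_pow, aeval_X, aeval_C]
        linear_combination -hde
      rw [this]
      refine Ideal.add_mem _ ?_ he
      rw [pow_succ]
      exact Ideal.mul_mem_mul (Ideal.pow_mem_pow hs1 M) hc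
  have hII : ∀ (M : ℕ) (P : k[X]), aeval s P ∈ 𝔫 ^ M ↔ X ^ M ∣ P := by
    intro M P
    constructor
    · intro h
      by_contra hnd
      have hP0 : P ≠ 0 := by rintro rfl; exact hnd (dvd_zero _)
      obtain ⟨Q, hQ, hQ'⟩ := exists_eq_pow_rootMultiplicity_mul_and_not_dvd P hP0 0
      set r := P.rootMultiplicity 0
      rw [C_0, sub_zero] at hQ hQ'
      have hr : r < M := by
        by_contra! hle
        exact hnd (by rw [hQ]; exact (pow_dvd_pow _ hle).mul_right _)
      rw [hQ, map_mul, map_pow, aeval_X, mul_comm] at h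
      have h' := Ideal.pow_le_pow_right (show r + 1 ≤ M from hr) h
      rcases Ideal.IsPrime.mul_mem_pow 𝔫 h' with h1 | h1
      · rw [X_dvd_iff] at hQ'
        apply hQ'
        apply hC
        rw [← divX_mul_X_add Q, map_add, map_mul, aeval_X, aeval_C] at h1
        exact (Ideal.add_mem_iff_right _ (Ideal.mul_mem_left _ _ hs1)).1 h1
      · exact hsr r h1
    · rintro ⟨Q, rfl⟩
      rw [map_mul, map_pow, aeval_X]
      exact Ideal.mul_mem_right _ _ (Ideal.pow_mem_pow hs1 M)
  obtain ⟨D, hD1, hD2⟩ : ∃ D, b ∈ 𝔫 ^ D ∧ b ∉ 𝔫 ^ (D + 1) := by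
    classical
    have hex : ∃ i, b ∉ 𝔫 ^ i := by
      by_contra! h
      apply hb
      have := Ideal.iInf_pow_eq_bot_of_isDomain 𝔫 hne
      rw [← Ideal.mem_bot, ← this]
      simpa using h
    have h1 := Nat.find_spec hex
    have h2 : Nat.find hex ≠ 0 := fun h => by rw [h] at h1; simp at h1
    obtain ⟨D, hD⟩ := Nat.exists_eq_succ_of_ne_zero h2
    refine ⟨D, ?_, by rw [hD] at h1; exact h1⟩
    have := Nat.find_min hex (m := D) (by omega)
    simpa using this
  choose P hP using fun j l => hI (D + 1) (y j l)
  have hcong : ∀ j (F : MvPolynomial (Fin m) ℤ),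
      X ^ (D + 1) ∣ MvPolynomial.aeval (P j) F ↔ MvPolynomial.aeval (y j) F ∈ 𝔫 ^ (D + 1) := by
    intro j F
    rw [← hII]
    have e0 := aeval_ringHom_comp (aeval s : k[X] →ₐ[k] S).toRingHom (P j) F
    have e1 := aeval_ringHom_comp (Ideal.Quotient.mk (𝔫 ^ (D + 1))) (y j) F
    have e2 := aeval_ringHom_comp (Ideal.Quotient.mk (𝔫 ^ (D + 1))) (fun l => aeval s (P j l)) F
    have e3 : (fun l => Ideal.Quotient.mk (𝔫 ^ (D + 1)) (y j l)) =
        fun l => Ideal.Quotient.mk (𝔫 ^ (D + 1)) (aeval s (P j l)) :=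
      funext fun l => Ideal.Quotient.eq.2 (hP j l)
    rw [e3, e2] at e1
    rw [← Ideal.Quotient.eq_zero_iff_mem, ← Ideal.Quotient.eq_zero_iff_mem, ← e1]
    exact Eq.congr (congrArg _ e0.symm) rfl
  refine ⟨D + 1, P, fun i j => ?_, fun i => ?_⟩
  · rw [hcong]
    obtain ⟨c, hc, h⟩ := hf i j
    rw [h, pow_succ]
    exact Ideal.mul_mem_mul hD1 hc
  · rw [hcong]
    intro h
    obtain ⟨w, hw⟩ := hg i
    exact hD2 (by rw [hw]; exact Ideal.mul_mem_right _ _ h)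

open Polynomial in
lemma partD2core {p : ℕ} [Fact p.Prime] {k B L F : Type*} [Field k] [IsAlgClosed k] [CharP k p]
    [CommRing B] [IsDomain B] [Algebra k[X] B] [Field L] [Field F] [Algebra k[X] L]
    [IsFractionRing k[X] L] [Algebra B F] [IsFractionRing B F] [Algebra L F] [Algebra k[X] F]
    [IsScalarTower k[X] L F] [IsScalarTower k[X] B F] [FiniteDimensional L F]
    [Algebra.IsIntegral k[X] B]
    (𝔪 : Ideal B) [𝔪.IsMaximal] (hX : algebraMap k[X] B X ∈ 𝔪)
    {n m : ℕ} (f g : Fin n → MvPolynomial (Fin m) ℤ) (y : Fin n → Fin m → B) (b : B) (hb : b ≠ 0)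
    (hf : ∀ i j, ∃ c ∈ 𝔪, MvPolynomial.aeval (y j) (f i) = b * c)
    (hg : ∀ i, MvPolynomial.aeval (y i) (g i) ∣ b) :
    ∃ (M : ℕ) (P : Fin n → Fin m → k[X]), (∀ i j, X ^ M ∣ MvPolynomial.aeval (P j) (f i)) ∧
      ∀ i, ¬ X ^ M ∣ MvPolynomial.aeval (P i) (g i) := by
  have hcL : CharP L p :=
    charP_of_injective_algebraMap (IsFractionRing.injective k[X] L) p
  let E := separableClosure L F
  have hEF : IsScalarTower k[X] E F := IsScalarTower.of_algebraMap_eq fun _ => rfl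
  have hcE : CharP E p := charP_of_injective_algebraMap (algebraMap L E).injective p
  have : ExpChar E p := ExpChar.prime Fact.out
  set e := IsPurelyInseparable.exponent E F
  let θ : F →+* E := IsPurelyInseparable.iterateFrobenius E F p (le_refl e)
  have hθ : ∀ a : F, algebraMap E F (θ a) = a ^ p ^ e := fun a =>
    IsPurelyInseparable.algebraMap_iterateFrobenius E p (le_refl e) a
  have hpe : p ^ e ≠ 0 := pow_ne_zero _ (Fact.out : p.Prime).ne_zero
  have hDed : IsDedekindDomain (integralClosure k[X] E) :=
    integralClosure.isDedekindDomain k[X] L E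
  have hIntegral : ∀ x : B, θ (algebraMap B F x) ∈ integralClosure k[X] E := by
    intro x
    change IsIntegral k[X] _
    rw [← isIntegral_algebraMap_iff (algebraMap E F).injective, hθ]
    exact ((Algebra.IsIntegral.isIntegral (R := k[X]) x).map (IsScalarTower.toAlgHom k[X] B F)).pow _
  let θ0 : B →+* integralClosure k[X] E :=
    (θ.comp (algebraMap B F)).codRestrict (integralClosure k[X] E) hIntegral
  have hτint : ∀ x : integralClosure k[X] E, algebraMap E F x ∈ integralClosure B F := by
    intro x
    change IsIntegral B _
    have h1 : IsIntegral k[X] (x : E) := x.2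
    exact (h1.map (IsScalarTower.toAlgHom k[X] E F)).tower_top
  let τ : integralClosure k[X] E →+* integralClosure B F :=
    ((algebraMap E F).comp (algebraMap (integralClosure k[X] E) E)).codRestrict
      (integralClosure B F) hτint
  have hBT : Function.Injective (algebraMap B (integralClosure B F)) := by
    intro a b hab
    apply IsFractionRing.injective B F
    exact congrArg Subtype.val hab
  obtain ⟨𝔐, h𝔐, h𝔐c⟩ := Ideal.exists_ideal_over_maximal_of_isIntegral
    (S := integralClosure B F) 𝔪 (by
      rw [(RingHom.injective_iff_ker_eq_bot _).1 hBT]; exact bot_le)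
  let 𝔫 := 𝔐.comap τ
  have h𝔫 : 𝔫.IsPrime := Ideal.IsPrime.comap τ
  have hτθ : ∀ x : B, τ (θ0 x) = algebraMap B _ x ^ p ^ e := by
    intro x
    apply Subtype.ext
    exact hθ _
  have hmem : ∀ c ∈ 𝔪, θ0 c ∈ 𝔫 := by
    intro c hc
    change τ (θ0 c) ∈ 𝔐
    rw [hτθ]
    refine Ideal.pow_mem_of_mem _ ?_ _ (Nat.pos_of_ne_zero hpe)
    rw [← h𝔐c] at hc
    exact hc
  have hθ0 : Function.Injective θ0 := by
    intro a b hab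
    apply IsFractionRing.injective B F
    apply θ.injective
    exact congrArg Subtype.val hab
  have hX' : algebraMap k[X] (integralClosure k[X] E) X ∈ 𝔫 := by
    change τ _ ∈ 𝔐
    have : τ (algebraMap k[X] (integralClosure k[X] E) X) =
        algebraMap B (integralClosure B F) (algebraMap k[X] B X) := by
      apply Subtype.ext
      change algebraMap E F (algebraMap k[X] E X) = algebraMap B F (algebraMap k[X] B X)
      rw [← IsScalarTower.algebraMap_apply, ← IsScalarTower.algebraMap_apply]
    rw [this]
    rw [← h𝔐c] at hX
    exact hX
  have hSinj : Function.Injective (algebraMap k[X] (integralClosure k[X] E)) := by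
    intro a b hab
    apply IsFractionRing.injective k[X] L
    apply (algebraMap L E).injective
    rw [← IsScalarTower.algebraMap_apply, ← IsScalarTower.algebraMap_apply]
    exact congrArg Subtype.val hab
  have h0 : 𝔫 ≠ ⊥ := by
    intro h
    rw [h, Ideal.mem_bot, map_eq_zero_iff _ hSinj] at hX'
    exact X_ne_zero hX'
  let : Algebra k (integralClosure k[X] E) :=
    ((algebraMap k[X] (integralClosure k[X] E)).comp C).toAlgebra
  have halg : ∀ c : k, algebraMap k (integralClosure k[X] E) c =
      algebraMap k[X] (integralClosure k[X] E) (C c) := fun c => rfl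
  have hres : ∀ x : integralClosure k[X] E, ∃ c : k, x - algebraMap k _ c ∈ 𝔫 := by
    have hfac : (Ideal.Quotient.mk 𝔫).comp (algebraMap k[X] (integralClosure k[X] E)) =
        (algebraMap k (integralClosure k[X] E ⧸ 𝔫)).comp (evalRingHom 0) := by
      apply Polynomial.ringHom_ext
      · intro a
        simp only [RingHom.comp_apply, coe_evalRingHom, eval_C]
        rfl
      · simp only [RingHom.comp_apply, coe_evalRingHom, eval_X, map_zero]
        exact Ideal.Quotient.eq_zero_iff_mem.2 hX'
    have hi : (algebraMap k (integralClosure k[X] E ⧸ 𝔫)).IsIntegral := by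
      apply RingHom.IsIntegral.tower_top (evalRingHom (0 : k))
      rw [← hfac]
      refine RingHom.IsIntegral.trans _ _ ?_ ?_
      · exact fun x => Algebra.IsIntegral.isIntegral (R := k[X]) x
      · exact RingHom.isIntegral_of_surjective _ Ideal.Quotient.mk_surjective
    have : Algebra.IsIntegral k (integralClosure k[X] E ⧸ 𝔫) := ⟨hi⟩
    intro x
    obtain ⟨c, hc⟩ := (IsAlgClosed.algebraMap_bijective_of_isIntegral (k := k)
      (K := integralClosure k[X] E ⧸ 𝔫)).2 (Ideal.Quotient.mk 𝔫 x)
    exact ⟨c, Ideal.Quotient.eq.1 hc.symm⟩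
  refine partD1 𝔫 h0 hres f g (fun j l => θ0 (y j l)) (θ0 b)
    (by rwa [Ne, map_eq_zero_iff _ hθ0]) (fun i j => ?_) (fun i => ?_)
  · obtain ⟨c, hc, h⟩ := hf i j
    exact ⟨θ0 c, hmem c hc, by rw [aeval_ringHom_comp, h, map_mul]⟩
  · rw [aeval_ringHom_comp]
    exact map_dvd _ (hg i)

open Polynomial in
lemma partD2 {p : ℕ} [Fact p.Prime] {k B : Type*} [Field k] [IsAlgClosed k] [CharP k p]
    [CommRing B] [IsDomain B] [Algebra k[X] B] [Module.Finite k[X] B]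
    (hinj : Function.Injective (algebraMap k[X] B))
    (𝔪 : Ideal B) [𝔪.IsMaximal] (hX : algebraMap k[X] B X ∈ 𝔪)
    {n m : ℕ} (f g : Fin n → MvPolynomial (Fin m) ℤ) (y : Fin n → Fin m → B) (b : B) (hb : b ≠ 0)
    (hf : ∀ i j, ∃ c ∈ 𝔪, MvPolynomial.aeval (y j) (f i) = b * c)
    (hg : ∀ i, MvPolynomial.aeval (y i) (g i) ∣ b) :
    ∃ (M : ℕ) (P : Fin n → Fin m → k[X]), (∀ i j, X ^ M ∣ MvPolynomial.aeval (P j) (f i)) ∧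
      ∀ i, ¬ X ^ M ∣ MvPolynomial.aeval (P i) (g i) := by
  have : FaithfulSMul k[X] B := (faithfulSMul_iff_algebraMap_injective _ _).2 hinj
  have : FaithfulSMul k[X] (FractionRing B) := by
    rw [faithfulSMul_iff_algebraMap_injective, IsScalarTower.algebraMap_eq k[X] B (FractionRing B)]
    exact (IsFractionRing.injective B (FractionRing B)).comp hinj
  let : Algebra (FractionRing k[X]) (FractionRing B) := FractionRing.liftAlgebra k[X] _
  have : IsScalarTower k[X] (FractionRing k[X]) (FractionRing B) :=
    FractionRing.isScalarTower_liftAlgebra _ _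
  have : FiniteDimensional (FractionRing k[X]) (FractionRing B) :=
    .of_isLocalization k[X] B (nonZeroDivisors k[X])
  exact partD2core (p := p) (L := FractionRing k[X]) (F := FractionRing B) 𝔪 hX f g y b hb hf hg

open Polynomial in
lemma partD3 {p : ℕ} [Fact p.Prime] {k R : Type*} [Field k] [IsAlgClosed k] [CharP k p]
    [CommRing R] [IsDomain R] [Algebra k R] [Algebra.FiniteType k R] (τ : R)
    (hτ : Transcendental k τ) (𝔪 : Ideal R) [𝔪.IsMaximal]
    {n m : ℕ} (f g : Fin n → MvPolynomial (Fin m) ℤ) (y : Fin n → Fin m → R) (b : R) (hb : b ≠ 0)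
    (hf : ∀ i j, ∃ c ∈ 𝔪, MvPolynomial.aeval (y j) (f i) = b * c)
    (hg : ∀ i, MvPolynomial.aeval (y i) (g i) ∣ b) :
    ∃ (M : ℕ) (P : Fin n → Fin m → k[X]), (∀ i j, X ^ M ∣ MvPolynomial.aeval (P j) (f i)) ∧
      ∀ i, ¬ X ^ M ∣ MvPolynomial.aeval (P i) (g i) := by
  obtain ⟨s, φ, hφi, hφf⟩ := exists_finite_inj_algHom_of_fg k R
  -- positivity of the number of variables
  have hs : s ≠ 0 := by
    rintro rfl
    apply hτ
    have h1 : (φ.toRingHom.comp MvPolynomial.C).IsIntegral := by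
      refine RingHom.IsIntegral.trans _ _ ?_ ?_
      · exact RingHom.isIntegral_of_surjective _ (MvPolynomial.C_surjective _)
      · exact RingHom.Finite.to_isIntegral hφf
    have h2 : φ.toRingHom.comp MvPolynomial.C = algebraMap k R := φ.comp_algebraMap
    rw [h2] at h1
    exact IsIntegral.isAlgebraic (h1 τ)
  obtain ⟨s, rfl⟩ := Nat.exists_eq_succ_of_ne_zero hs
  let _ : Algebra (MvPolynomial (Fin (s + 1)) k) R := φ.toRingHom.toAlgebra
  have hφ : ∀ z, algebraMap (MvPolynomial (Fin (s + 1)) k) R z = φ z := fun _ => rfl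
  have : Module.Finite (MvPolynomial (Fin (s + 1)) k) R := hφf
  have : FaithfulSMul (MvPolynomial (Fin (s + 1)) k) R :=
    (faithfulSMul_iff_algebraMap_injective _ _).2 hφi
  have hmax := Ideal.isMaximal_comap_of_isIntegral_of_isMaximal
    (R := MvPolynomial (Fin (s + 1)) k) 𝔪
  obtain ⟨x, hx⟩ := MvPolynomial.isMaximal_iff_eq_vanishingIdeal_singleton.1 hmax
  have hx' : ∀ z, φ z ∈ 𝔪 ↔ MvPolynomial.eval x z = 0 := by
    intro z
    have h1 : z ∈ Ideal.comap (algebraMap (MvPolynomial (Fin (s + 1)) k) R) 𝔪 ↔ φ z ∈ 𝔪 := Iff.rfl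
    rw [← h1, hx, MvPolynomial.mem_vanishingIdeal_singleton_iff]
    exact Iff.of_eq (congrArg (· = 0) (RingHom.congr_fun (MvPolynomial.coe_aeval_eq_eval x) z))
  obtain ⟨b0, hb0, hbb⟩ : ∃ b0 : MvPolynomial (Fin (s + 1)) k, b0 ≠ 0 ∧ b ∣ φ b0 := by
    have h1 := Ideal.comap_ne_bot_of_integral_mem (R := MvPolynomial (Fin (s + 1)) k) hb
      (Ideal.mem_span_singleton_self b) (Algebra.IsIntegral.isIntegral b)
    obtain ⟨b0, h2, h3⟩ := Submodule.exists_mem_ne_zero_of_ne_bot h1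
    exact ⟨b0, h3, Ideal.mem_span_singleton.1 h2⟩
  obtain ⟨w, hw⟩ : ∃ w : Fin (s + 1) → k,
      MvPolynomial.eval w (b0 * (MvPolynomial.X 0 - MvPolynomial.C (x 0))) ≠ 0 := by
    by_contra! h
    have h1 : b0 * (MvPolynomial.X 0 - MvPolynomial.C (x 0)) = 0 :=
      MvPolynomial.funext fun w => by rw [h, map_zero]
    rcases mul_eq_zero.1 h1 with h2 | h2
    · exact hb0 h2
    · have h3 := congrArg (MvPolynomial.eval (fun _ => x 0 + 1)) h2
      simp at h3
  rw [map_mul] at hw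
  have hw1 := left_ne_zero_of_mul hw
  have hw2 : w 0 - x 0 ≠ 0 := by simpa using right_ne_zero_of_mul hw
  let α : MvPolynomial (Fin (s + 1)) k →ₐ[k] k[X] :=
    MvPolynomial.aeval fun i => C (x i) + C (w i - x i) * X
  have hα : ∀ (t : k) z, eval t (α z) = MvPolynomial.eval (fun i => x i + (w i - x i) * t) z := by
    intro t z
    have : (evalRingHom t).comp α.toRingHom =
        MvPolynomial.eval (fun i => x i + (w i - x i) * t) := by
      apply MvPolynomial.ringHom_ext
      · intro a; simp [α]
      · intro i; simp [α]
    exact RingHom.congr_fun this z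
  have hα0 : ∀ z, eval 0 (α z) = MvPolynomial.eval x z := fun z => by simpa using hα 0 z
  have hα1 : ∀ z, eval 1 (α z) = MvPolynomial.eval w z := fun z => by simpa using hα 1 z
  have hαs : Function.Surjective α := by
    rw [← AlgHom.range_eq_top, eq_top_iff, ← Polynomial.adjoin_X]
    refine Algebra.adjoin_le ?_
    rintro _ rfl
    refine ⟨MvPolynomial.C (w 0 - x 0)⁻¹ * (MvPolynomial.X 0 - MvPolynomial.C (x 0)), ?_⟩
    have e1 : α (MvPolynomial.C (w 0 - x 0)⁻¹ * (MvPolynomial.X 0 - MvPolynomial.C (x 0)))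
        = C (w 0 - x 0)⁻¹ * (C (w 0 - x 0) * X) := by
      simp [α]
    refine e1.trans ?_
    rw [← mul_assoc, ← C_mul, inv_mul_cancel₀ hw2, C_1, one_mul]
  let q0 := RingHom.ker α.toRingHom
  have hq0 : q0.IsPrime := RingHom.ker_isPrime _
  have hq0' : ∀ z, z ∈ q0 ↔ α z = 0 := fun z => RingHom.mem_ker
  have hq0m : q0 ≤ Ideal.comap (algebraMap (MvPolynomial (Fin (s + 1)) k) R) 𝔪 := by
    intro z hz
    change φ z ∈ 𝔪
    rw [hx', ← hα0, (hq0' z).1 hz, eval_zero]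
  have : 𝔪.LiesOver (Ideal.comap (algebraMap (MvPolynomial (Fin (s + 1)) k) R) 𝔪) := ⟨rfl⟩
  obtain ⟨q, hqm, hq, hqover⟩ := Ideal.exists_ideal_le_liesOver_of_le 𝔪 hq0m
  have hqq : ∀ z, φ z ∈ q ↔ α z = 0 := fun z => by
    rw [← hq0', Ideal.mem_of_liesOver q q0 z, hφ]
  let γ : k[X] →+* R ⧸ q := RingHom.liftOfSurjective α.toRingHom hαs
    ⟨(Ideal.Quotient.mk q).comp φ.toRingHom, fun z hz => by
      change Ideal.Quotient.mk q (φ z) = 0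
      rw [Ideal.Quotient.eq_zero_iff_mem, hqq]
      exact hz⟩
  have hγ : ∀ z, γ (α z) = Ideal.Quotient.mk q (φ z) := fun z =>
    RingHom.liftOfSurjective_comp_apply α.toRingHom hαs _ z
  have hγi : Function.Injective γ := by
    rw [injective_iff_map_eq_zero]
    intro u hu
    obtain ⟨z, rfl⟩ := hαs u
    rwa [hγ, Ideal.Quotient.eq_zero_iff_mem, hqq] at hu
  have hγf : γ.Finite := by
    apply RingHom.Finite.of_comp_finite (f := α.toRingHom)
    have : γ.comp α.toRingHom = (Ideal.Quotient.mk q).comp φ.toRingHom := RingHom.ext hγ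
    rw [this]
    exact RingHom.Finite.comp (RingHom.Finite.of_surjective _ Ideal.Quotient.mk_surjective) hφf
  let _ : Algebra k[X] (R ⧸ q) := γ.toAlgebra
  have : Module.Finite k[X] (R ⧸ q) := hγf
  have hmax' : (𝔪.map (Ideal.Quotient.mk q)).IsMaximal :=
    Ideal.IsMaximal.map_of_surjective_of_ker_le Ideal.Quotient.mk_surjective
      (by rw [Ideal.mk_ker]; exact hqm)
  refine partD2 (p := p) (k := k) (B := R ⧸ q) hγi (𝔪.map (Ideal.Quotient.mk q)) ?_ f g
    (fun j l => Ideal.Quotient.mk q (y j l)) (Ideal.Quotient.mk q b) ?_ (fun i j => ?_)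
    (fun i => ?_)
  · change γ X ∈ _
    obtain ⟨z, hz⟩ := hαs X
    rw [← hz, hγ]
    apply Ideal.mem_map_of_mem
    rw [hx', ← hα0, hz, eval_X]
  · rw [Ne, Ideal.Quotient.eq_zero_iff_mem]
    intro h
    apply hw1
    rw [← hα1, (hqq b0).1 (Ideal.mem_of_dvd _ hbb h), eval_zero]
  · obtain ⟨c, hc, h⟩ := hf i j
    exact ⟨Ideal.Quotient.mk q c, Ideal.mem_map_of_mem _ hc, by
      rw [aeval_ringHom_comp, h, map_mul]⟩
  · rw [aeval_ringHom_comp]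
    exact map_dvd _ (hg i)

open Polynomial in
lemma partD4 (p : ℕ) [Fact p.Prime] (n m : ℕ) (hn : 0 < n) (f g : Fin n → MvPolynomial (Fin m) ℤ)
    (K k : Type*) [Field K] [Field k] [Algebra k K] [IsAlgClosed k] [CharP k p]
    [Algebra (ZMod p) k] [Algebra.IsAlgebraic (ZMod p) k]
    (Γ₀ : Type*) [LinearOrderedCommGroupWithZero Γ₀]
    (v : Valuation K Γ₀) (τ : K) (hτ0 : τ ≠ 0) (hτ : v τ < 1)
    (x : Fin n → Fin m → K) (hx : ∀ j l, v (x j l) ≤ 1)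
    (H : ∀ i j k : Fin n,
      v (MvPolynomial.aeval (x j) (f i)) < v (MvPolynomial.aeval (x k) (g k))) :
    ∃ (M : ℕ) (P : Fin n → Fin m → k[X]), (∀ i j, X ^ M ∣ MvPolynomial.aeval (P j) (f i)) ∧
      ∀ i, ¬ X ^ M ∣ MvPolynomial.aeval (P i) (g i) := by
  have hvk1 : ∀ c : k, c ≠ 0 → v (algebraMap k K c) = 1 := by
    intro c hc
    obtain ⟨N, hN, h⟩ := isAlgebraic_zmod_pow_eq_one (p := p) c hc
    exact val_eq_one_of_pow v _ N hN (by rw [← map_pow, h, map_one])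
  have hvk : ∀ c : k, v (algebraMap k K c) ≤ 1 := by
    intro c
    by_cases hc : c = 0
    · simp [hc]
    · exact (hvk1 c hc).le
  have hn' : Nonempty (Fin n) := ⟨⟨0, hn⟩⟩
  obtain ⟨k0, hk0⟩ := Finite.exists_min fun k => v (MvPolynomial.aeval (x k) (g k))
  set b := MvPolynomial.aeval (x k0) (g k0) with hbdef
  have hvb : v b ≠ 0 := ((zero_le).trans_lt (H k0 k0 k0)).ne'
  have hb : b ≠ 0 := (v.ne_zero_iff).1 hvb
  have hvg : ∀ k, v (MvPolynomial.aeval (x k) (g k)) ≠ 0 := fun k =>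
    ((zero_le).trans_lt (H k k k)).ne'
  let cf : Fin n × Fin n → K := fun ij => MvPolynomial.aeval (x ij.2) (f ij.1) / b
  let wg : Fin n → K := fun k => b / MvPolynomial.aeval (x k) (g k)
  have hcf : ∀ ij, v (cf ij) < 1 := by
    intro ij
    simp only [cf, map_div₀]
    exact (div_lt_one₀ (zero_lt_iff.2 hvb)).2 (H _ _ _)
  have hwg : ∀ k, v (wg k) ≤ 1 := by
    intro k
    simp only [wg, map_div₀]
    exact (div_le_one₀ (zero_lt_iff.2 (hvg k))).2 (hk0 k)
  let T : Set K := Set.range (fun jl : Fin n × Fin m => x jl.1 jl.2) ∪ Set.range cf ∪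
    Set.range wg ∪ {τ}
  have hTfin : T.Finite := (((Set.finite_range _).union (Set.finite_range _)).union
    (Set.finite_range _)).union (Set.finite_singleton _)
  let R := Algebra.adjoin k T
  have hft : Algebra.FiniteType k R :=
    (Subalgebra.fg_iff_finiteType _).1 (Subalgebra.fg_def.2 ⟨T, hTfin, rfl⟩)
  have hT : ∀ t ∈ T, v t ≤ 1 := by
    rintro t (((⟨jl, rfl⟩ | ⟨ij, rfl⟩) | ⟨k, rfl⟩) | rfl)
    · exact hx _ _
    · exact (hcf ij).le
    · exact hwg k
    · exact hτ.le
  have hR : ∀ r : R, v (r : K) ≤ 1 := by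
    rintro ⟨r, hr⟩
    induction hr using Algebra.adjoin_induction with
    | mem t ht => exact hT t ht
    | algebraMap c => exact hvk c
    | add a b _ _ ha hb => exact v.map_add_le ha hb
    | mul a b _ _ ha hb =>
      change v (a * b) ≤ 1
      rw [map_mul]
      exact mul_le_one' ha hb
  let 𝔭 : Ideal R :=
    { carrier := {r | v (r : K) < 1}
      zero_mem' := by simp
      add_mem' := fun {a b} ha hb => v.map_add_lt ha hb
      smul_mem' := fun a b hb => by
        change v ((a : K) * b) < 1
        rw [map_mul]
        exact mul_lt_one_of_nonneg_of_lt_one_right (hR a) zero_le hb }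
  have h𝔭 : 𝔭 ≠ ⊤ := by
    rw [Ideal.ne_top_iff_one]
    change ¬ v ((1 : R) : K) < 1
    simp
  obtain ⟨𝔪, h𝔪, hle⟩ := Ideal.exists_le_maximal 𝔭 h𝔭
  have hxR : ∀ j l, x j l ∈ R := fun j l =>
    Algebra.subset_adjoin (Or.inl (Or.inl (Or.inl ⟨(j, l), rfl⟩)))
  have hcR : ∀ ij, cf ij ∈ R := fun ij =>
    Algebra.subset_adjoin (Or.inl (Or.inl (Or.inr ⟨ij, rfl⟩)))
  have hwR : ∀ i, wg i ∈ R := fun i => Algebra.subset_adjoin (Or.inl (Or.inr ⟨i, rfl⟩))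
  have hτR : τ ∈ R := Algebra.subset_adjoin (Or.inr rfl)
  let y : Fin n → Fin m → R := fun j l => ⟨x j l, hxR j l⟩
  have hy : ∀ j (F : MvPolynomial (Fin m) ℤ),
      ((MvPolynomial.aeval (y j) F : R) : K) = MvPolynomial.aeval (x j) F := fun j F =>
    (aeval_ringHom_comp (algebraMap R K) (y j) F).symm
  have htr : Transcendental k (⟨τ, hτR⟩ : R) := by
    intro halg
    have h1 : IsAlgebraic k τ := halg.algebraMap (A := K)
    have h2 : IsIntegral k τ := h1.isIntegral
    obtain ⟨c, hc⟩ := minpoly.mem_range_of_degree_eq_one k τ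
      (IsAlgClosed.degree_eq_one_of_irreducible k (minpoly.irreducible h2))
    have hc0 : c ≠ 0 := by rintro rfl; exact hτ0 (by rw [← hc, map_zero])
    have := hvk1 c hc0
    rw [hc] at this
    exact hτ.ne this
  refine partD3 (p := p) (⟨τ, hτR⟩ : R) htr 𝔪 f g y (MvPolynomial.aeval (y k0) (g k0)) ?_
    (fun i j => ⟨⟨cf (i, j), hcR _⟩, hle (hcf _), ?_⟩) (fun i => ⟨⟨wg i, hwR i⟩, ?_⟩)
  · intro h
    apply hb
    rw [hbdef, ← hy, h]
    rfl
  · apply Subtype.ext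
    change _ = ((MvPolynomial.aeval (y k0) (g k0) : R) : K) * cf (i, j)
    rw [hy, hy, ← hbdef]
    exact (mul_div_cancel₀ _ hb).symm
  · apply Subtype.ext
    change _ = ((MvPolynomial.aeval (y i) (g i) : R) : K) * wg i
    rw [hy, hy, ← hbdef]
    exact (mul_div_cancel₀ _ ((v.ne_zero_iff).1 (hvg i))).symm

/-- Fix a prime `p`, `n, m ≥ 1` and integer polynomials `f i, g i`.
For any algebraically closed field `K` of characteristic `p` with a nontrivial
valuation `v`, the system `f i = 0, g i ≠ 0` has a solution in `ℤ^ab/pℤ^ab` iff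
there are tuples `x 1, …, x n` over the valuation ring with
`v (f i (x j)) < v (g k (x k))` for all `i, j, k`. -/
theorem stmt0 (p : ℕ) (hp : p.Prime) (n m : ℕ) (hn : 1 ≤ n) (hm : 1 ≤ m)
    (f g : Fin n → MvPolynomial (Fin m) ℤ)
    (K : Type*) [Field K] [IsAlgClosed K] [CharP K p]
    (Γ₀ : Type*) [LinearOrderedCommGroupWithZero Γ₀]
    (v : Valuation K Γ₀) (hv : ∃ a : K, v a ≠ 0 ∧ v a ≠ 1) :
    (∃ x : Fin m → ZabMod p, ∀ i : Fin n,
        MvPolynomial.aeval x (f i) = 0 ∧ MvPolynomial.aeval x (g i) ≠ 0) ↔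
    (∃ x : Fin n → Fin m → K, (∀ j l, v (x j l) ≤ 1) ∧
        ∀ i j k : Fin n,
          v (MvPolynomial.aeval (x j) (f i)) < v (MvPolynomial.aeval (x k) (g k))) := by
  have : Fact p.Prime := ⟨hp⟩
  let : Algebra (ZMod p) K := ZMod.algebra K p
  have : IsAlgClosed (algebraicClosure (ZMod p) K) :=
    IsAlgClosure.isAlgClosed (ZMod p)
  have hk : CharP (algebraicClosure (ZMod p) K) p :=
    charP_of_injective_algebraMap (algebraMap (ZMod p) (algebraicClosure (ZMod p) K)).injective p
  obtain ⟨τ, hτ0, hτ⟩ : ∃ τ : K, τ ≠ 0 ∧ v τ < 1 := by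
    obtain ⟨a, ha0, ha1⟩ := hv
    have ha : a ≠ 0 := (v.ne_zero_iff).1 ha0
    rcases lt_or_gt_of_ne ha1 with h | h
    · exact ⟨a, ha, h⟩
    · exact ⟨a⁻¹, inv_ne_zero ha, by rw [map_inv₀]; exact inv_lt_one_of_one_lt₀ h⟩
  rw [zabMod_iff']
  constructor
  · intro H
    exact partB p n m f g K (algebraicClosure (ZMod p) K) Γ₀ v τ hτ0 hτ H
  · rintro ⟨x, hx, H⟩
    obtain ⟨M, P, h1, h2⟩ := partD4 p n m hn f g K (algebraicClosure (ZMod p) K) Γ₀ v τ hτ0 hτ x hx H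
    exact partC p n m hn f g (algebraicClosure (ZMod p) K) P M h1 h2

end
end

section
/- Fix natural numbers n, m ≥ 1 and polynomials f_1,…,f_n, g_1,…,g_n ∈ ℤ[x_1,…,x_m]. Let K be any algebraically closed field of characteristic 0 equipped with a nontrivial valuation v : K → Γ₀ satisfying v(k) = 1 for every nonzero integer k (so the residue characteristic is 0). Then for all but finitely many primes p the following equivalence holds: there exists x ∈ (ℤ^ab/pℤ^ab)^m with f_i(x) = 0 and g_i(x) ≠ 0 for all 1 ≤ i ≤ n, if and only if there exist m-tuples x_1,…,x_n with all entries in 𝒪_v such that v(f_i(x_j)) < v(g_k(x_k)) for all 1 ≤ i, j, k ≤ n. -/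
noncomputable section

section

open IsLocalRing

theorem hom_aeval {A B : Type*} [CommRing A] [CommRing B] {iA : Algebra ℤ A} {iB : Algebra ℤ B}
    {m : ℕ} (φ : A →+* B) (x : Fin m → A) (h : MvPolynomial (Fin m) ℤ) :
    φ (MvPolynomial.aeval x h) = MvPolynomial.aeval (fun l => φ (x l)) h := by
  simp only [MvPolynomial.aeval_def]
  rw [MvPolynomial.hom_eval₂]
  congr 1
  exact RingHom.ext_int _ _

theorem dvr_aux {R : Type*} [CommRing R] [IsDomain R] [IsNoetherianRing R] [IsLocalRing R]
    [IsIntegrallyClosed R] (b c : R) (hb : b ≠ 0) (hbc : ¬ b ∣ c) 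
    (hm : ∀ y ∈ maximalIdeal R, b ∣ y * c) : IsDiscreteValuationRing R := by
  have hc : c ≠ 0 := by rintro rfl; exact hbc (dvd_zero _)
  have hbm : b ∈ maximalIdeal R := by
    rw [mem_maximalIdeal, mem_nonunits_iff]
    intro h; exact hbc (h.dvd)
  have hbot : maximalIdeal R ≠ ⊥ := by
    intro h; rw [h] at hbm; exact hb (by simpa using hbm)
  have hfield : ¬ IsField R := isField_iff_maximalIdeal_eq.not.mpr hbot
  refine ((IsDiscreteValuationRing.TFAE R hfield).out 0 4).mpr ?_
  by_cases hex : ∃ π ∈ maximalIdeal R, ∃ ε : R, IsUnit ε ∧ π * c = b * ε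
  · obtain ⟨π, hπ, ε, hε, h⟩ := hex
    refine ⟨π, le_antisymm ?_ ((Ideal.span_singleton_le_iff_mem _).2 hπ)⟩
    intro y hy
    obtain ⟨z, hz⟩ := hm y hy
    obtain ⟨ε', hε'⟩ := hε.exists_right_inv
    refine Ideal.mem_span_singleton.2 ⟨z * ε', ?_⟩
    apply mul_right_cancel₀ hc
    linear_combination hz - z * ε' * h - b * z * hε'
  · exfalso
    push Not at hex
    let F := FractionRing R
    have hbF : algebraMap R F b ≠ 0 := by
      simpa using hb
    let t : F := algebraMap R F c / algebraMap R F b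
    have hint : IsIntegral R t := by
      refine isIntegral_of_smul_mem_submodule (M := F)
        (Submodule.map (Algebra.linearMap R F) (maximalIdeal R)) ?_ ?_ t ?_
      · intro h
        have : Algebra.linearMap R F b ∈ Submodule.map (Algebra.linearMap R F) (maximalIdeal R) :=
          ⟨b, hbm, rfl⟩
        rw [h] at this
        exact hbF (by simpa using this)
      · exact Submodule.FG.map _ (IsNoetherian.noetherian _)
      · rintro _ ⟨y, hy, rfl⟩
        obtain ⟨z, hz⟩ := hm y hy
        refine ⟨z, ?_, ?_⟩
        · by_contra hzm
          have : IsUnit z := by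
            simpa [mem_maximalIdeal, mem_nonunits_iff] using hzm
          exact hex y hy z this hz
        · have := congrArg (algebraMap R F) hz
          simp only [map_mul] at this
          simp only [Algebra.linearMap_apply, t, smul_eq_mul]
          rw [div_mul_eq_mul_div, eq_div_iff hbF]
          linear_combination -this
    obtain ⟨y, hy⟩ := IsIntegrallyClosed.isIntegral_iff.1 hint
    apply hbc
    refine ⟨y, ?_⟩
    apply IsFractionRing.injective R F
    simp only [map_mul]
    rw [hy, mul_div_cancel₀ _ hbF]

theorem exists_dvr_localization {D : Type*} [CommRing D] [IsDomain D] [IsNoetherianRing D]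
    [IsIntegrallyClosed D] (a b : D) (hb : b ≠ 0) (hab : ¬ b ∣ a) :
    ∃ (P : Ideal D) (_ : P.IsPrime), IsDiscreteValuationRing (Localization.AtPrime P) ∧
      algebraMap D (Localization.AtPrime P) b ≠ 0 ∧
      ¬ algebraMap D (Localization.AtPrime P) b ∣ algebraMap D (Localization.AtPrime P) a := by
  obtain ⟨P, hP, hle⟩ := exists_le_isAssociatedPrime_of_isNoetherianRing D
    (Ideal.Quotient.mk (Ideal.span {b}) a) (by
      rwa [Ne, Ideal.Quotient.eq_zero_iff_mem, Ideal.mem_span_singleton])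
  obtain ⟨hp, c, hc⟩ := isAssociatedPrime_iff.1 hP
  obtain ⟨c, rfl⟩ := Ideal.Quotient.mk_surjective c
  have key : ∀ c r : D, r ∈ (⊥ : Submodule D (D ⧸ Ideal.span {b})).colon 
      {Ideal.Quotient.mk (Ideal.span {b}) c} ↔ b ∣ r * c := by
    intro c r
    rw [Submodule.mem_colon_singleton, Submodule.mem_bot, ← Ideal.mem_span_singleton,
      ← Ideal.Quotient.eq_zero_iff_mem, map_mul, Algebra.smul_def]; rfl
  have hcr : ∀ r, r ∈ P ↔ b ∣ r * c := fun r => by rw [← key, ← hc]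
  have hndvd : ∀ a : D, (∀ r, b ∣ r * a → r ∈ P) → 
      ¬ algebraMap D (Localization.AtPrime P) b ∣ algebraMap D (Localization.AtPrime P) a := by
    rintro a ha ⟨y, hy⟩
    obtain ⟨⟨z, s⟩, hz⟩ := IsLocalization.surj P.primeCompl y
    apply s.2
    apply ha
    refine ⟨z, ?_⟩
    apply IsLocalization.injective (Localization.AtPrime P) P.primeCompl_le_nonZeroDivisors
    simp only [map_mul] at hz ⊢
    rw [← hz, hy]; ring
  have hb0 : algebraMap D (Localization.AtPrime P) b ≠ 0 := by
    intro h
    exact hb (IsLocalization.injective (Localization.AtPrime P) P.primeCompl_le_nonZeroDivisors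
      (by simpa using h))
  refine ⟨P, hp, ?_, hb0, hndvd a fun r hr => hle ((key _ _).2 hr)⟩
  have : IsIntegrallyClosed (Localization.AtPrime P) :=
    isIntegrallyClosed_of_isLocalization _ P.primeCompl P.primeCompl_le_nonZeroDivisors
  have : IsNoetherianRing (Localization.AtPrime P) := 
    IsLocalization.isNoetherianRing P.primeCompl _ inferInstance
  refine dvr_aux (algebraMap D (Localization.AtPrime P) b) (algebraMap D (Localization.AtPrime P) c)
    hb0 (hndvd c fun r hr => (hcr r).2 hr) ?_
  · intro y hy
    rw [← Localization.AtPrime.map_eq_maximalIdeal] at hy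
    induction hy using Submodule.span_induction with
    | mem x h => 
      obtain ⟨r, hr, rfl⟩ := h
      rw [← map_mul]
      exact map_dvd _ ((hcr r).1 hr)
    | zero => simp
    | add x y _ _ h1 h2 => rw [add_mul]; exact dvd_add h1 h2
    | smul r x _ h => rw [smul_eq_mul, mul_assoc]; exact h.mul_left _

open Polynomial in
theorem exists_dvr_of_not_integral {R : Type} [CommRing R] [IsDomain R] [Algebra ℚ R]
    [Algebra.FiniteType ℚ R] (a b : R) (hb : b ≠ 0)
    (h : ∀ q : R[X], q.Monic → (q.scaleRoots b).eval a ≠ 0) :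
    ∃ (V : Type) (_ : CommRing V) (_ : IsDomain V) (_ : IsDiscreteValuationRing V)
      (φ : R →+* V), φ b ≠ 0 ∧ ¬ φ b ∣ φ a := by
  obtain ⟨s, G, hinj, hfin⟩ := exists_finite_inj_algHom_of_fg ℚ R
  let P := MvPolynomial (Fin s) ℚ
  let : Algebra P R := G.toRingHom.toAlgebra
  have : Module.Finite P R := hfin
  have : FaithfulSMul P R := (faithfulSMul_iff_algebraMap_injective P R).2 hinj
  have : Module.IsTorsionFree P R := inferInstance
  let F := FractionRing P
  let L := FractionRing R
  let : Algebra F L := FractionRing.liftAlgebra P L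
  have : FiniteDimensional F L := inferInstance
  have : CharZero P := inferInstance
  have : CharZero F := inferInstance
  have : Algebra.IsSeparable F L := inferInstance
  have : IsIntegrallyClosed P := inferInstance
  have : IsNoetherianRing P := inferInstance
  let D := integralClosure P L
  have : IsNoetherianRing D := integralClosure.isNoetherianRing (A := P) (K := F) L
  have : IsFractionRing D L := IsIntegralClosure.isFractionRing_of_finite_extension P F L D
  have : IsIntegrallyClosed D := (isIntegrallyClosed_iff L).mpr fun {x} hx =>
      ⟨IsIntegralClosure.mk' D x (isIntegral_trans (R := P) _ hx),
        IsIntegralClosure.algebraMap_mk' _ _ _⟩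
  let ι : R →+* D := (algebraMap R L).codRestrict D.toSubring (fun x => by
    have : IsIntegral P x := Algebra.IsIntegral.isIntegral x
    exact this.map (IsScalarTower.toAlgHom P R L))
  have hι : ∀ x, ((ι x : D) : L) = algebraMap R L x := fun x => rfl
  have hbL : algebraMap R L b ≠ 0 := by
    intro h0; exact hb (IsFractionRing.injective R L (by simpa using h0))
  have hb' : ι b ≠ 0 := by
    intro h0
    exact hbL (by rw [← hι, h0]; rfl)
  have hdvd : ¬ ι b ∣ ι a := by
    rintro ⟨y, hy⟩
    have hyP : IsIntegral P (y : L) := y.2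
    have hyR : IsIntegral R (y : L) := hyP.tower_top
    obtain ⟨q, hq, hq0⟩ := hyR
    apply h q hq
    apply IsFractionRing.injective R L
    have e : algebraMap R L a = algebraMap R L b * (y : L) := by
      rw [← hι, ← hι, hy]; rfl
    have := scaleRoots_eval₂_mul (p := q) (algebraMap R L) (y : L) b
    rw [← e, hq0, mul_zero, eval₂_at_apply] at this
    rw [this, map_zero]
  obtain ⟨Q, hQ, hV, h0, hnd⟩ := exists_dvr_localization (ι a) (ι b) hb' hdvd
  refine ⟨Localization.AtPrime Q, inferInstance, inferInstance, hV,
    (algebraMap D (Localization.AtPrime Q)).comp ι, h0, hnd⟩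

open Polynomial in
theorem dvr_coeff {V : Type} [CommRing V] [IsDomain V] [IsDiscreteValuationRing V]
    [Algebra ℚ V] (b : V) (hb : b ≠ 0) (hb1 : ¬ IsUnit b) {m : ℕ} (x : Fin m → V) :
    ∃ (κ : Type) (_ : Field κ) (_ : CharZero κ) (d : ℕ) (X : Fin m → κ[X]), 
      ∀ h : MvPolynomial (Fin m) ℤ, b ∣ MvPolynomial.aeval x h ↔ 
        (Polynomial.X : κ[X]) ^ d ∣ MvPolynomial.aeval X h := by
  obtain ⟨π, hπ⟩ := IsDiscreteValuationRing.exists_irreducible V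
  obtain ⟨d, hd⟩ := IsDiscreteValuationRing.associated_pow_irreducible hb hπ
  let κ := IsLocalRing.ResidueField V
  have : CharZero κ := algebraRat.charZero κ
  have : Algebra.FormallySmooth ℚ κ := by
    obtain ⟨s, hs⟩ := exists_isTranscendenceBasis ℚ κ
    have := hs.isAlgebraic
    have h2 : Algebra.IsAlgebraic (IntermediateField.adjoin ℚ (Set.range ((↑) : s → κ))) κ := by
      exact hs.isAlgebraic_field
    exact Algebra.FormallySmooth.of_algebraicIndependent_of_isSeparable hs.1
  have hd0 : d ≠ 0 := by
    rintro rfl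
    exact hb1 (by simpa using hd)
  let W := V ⧸ Ideal.span {π ^ d}
  let pr : V →ₐ[ℚ] W := Ideal.Quotient.mkₐ ℚ _
  have hpr : Function.Surjective pr := Ideal.Quotient.mk_surjective
  have hpr0 : ∀ y, pr y = 0 ↔ π ^ d ∣ y := fun y => by
    rw [← Ideal.mem_span_singleton]; exact Ideal.Quotient.eq_zero_iff_mem
  let res : V →ₐ[ℚ] κ := (IsLocalRing.residue V).toRatAlgHom
  have hres : ∀ y, res y = IsLocalRing.residue V y := fun y => rfl
  have hres0 : ∀ y, res y = 0 ↔ π ∣ y := fun y => by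
    rw [hres, IsLocalRing.residue_eq_zero_iff, hπ.maximalIdeal_eq, Ideal.mem_span_singleton]
  have hresπ : res π = 0 := (hres0 _).2 dvd_rfl
  let gg : W →ₐ[ℚ] κ := Ideal.Quotient.liftₐ _ res (by
    intro y hy
    rw [Ideal.mem_span_singleton] at hy
    exact (hres0 y).2 ((dvd_pow_self π hd0).trans hy))
  have hgg : ∀ y, gg (pr y) = res y := fun y => rfl
  have hggs : Function.Surjective gg := by
    intro y
    obtain ⟨z, rfl⟩ := IsLocalRing.residue_surjective y
    exact ⟨pr z, rfl⟩
  have hker : ∀ w, gg w = 0 → ∃ w', w = pr π * w' := by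
    intro w hw
    obtain ⟨y, rfl⟩ := hpr w
    rw [hgg, hres0] at hw
    obtain ⟨z, rfl⟩ := hw
    exact ⟨pr z, map_mul _ _ _⟩
  have hnil : IsNilpotent (RingHom.ker (gg : W →+* κ)) := by
    have hle : RingHom.ker (gg : W →+* κ) ≤ Ideal.span {pr π} := by
      intro w hw
      obtain ⟨w', h⟩ := hker w hw
      exact Ideal.mem_span_singleton.2 ⟨w', h⟩
    refine ⟨d, ?_⟩
    rw [Ideal.zero_eq_bot, eq_bot_iff]
    refine (Ideal.pow_right_mono hle d).trans ?_
    rw [Ideal.span_singleton_pow, ← map_pow, (hpr0 _).2 dvd_rfl]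
    simp
  let τ : κ →ₐ[ℚ] W := Algebra.FormallySmooth.liftOfSurjective (AlgHom.id ℚ κ) gg hggs hnil
  have hτ : ∀ y, gg (τ y) = y := fun y => 
    Algebra.FormallySmooth.liftOfSurjective_apply (AlgHom.id ℚ κ) gg hggs hnil y
  let Θ : κ[X] →+* W := eval₂RingHom (τ : κ →+* W) (pr π)
  have hΘX : Θ X = pr π := by simp [Θ]
  have hΘC : ∀ c, Θ (C c) = τ c := by intro c; simp [Θ]
  have hsurj : ∀ j : ℕ, ∀ w, ∃ P y, w = Θ P + pr π ^ j * y := by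
    intro j
    induction j with
    | zero => intro w; exact ⟨0, w, by simp⟩
    | succ j ih =>
      intro w
      obtain ⟨P, y, h⟩ := ih w
      obtain ⟨y', hy'⟩ := hker (y - τ (gg y)) (by rw [map_sub, hτ, sub_self])
      refine ⟨P + C (gg y) * X ^ j, y', ?_⟩
      rw [map_add, map_mul, map_pow, hΘX, hΘC, h]
      linear_combination pr π ^ j * hy'
  have hπd : pr π ^ d = 0 := by rw [← map_pow, (hpr0 _).2 dvd_rfl]
  have hsurj' : Function.Surjective Θ := by
    intro w
    obtain ⟨P, y, h⟩ := hsurj d w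
    exact ⟨P, by rw [h, hπd]; ring⟩
  have hggΘ : ∀ P, gg (Θ P) = P.coeff 0 := by
    intro P
    have : (gg : W →+* κ).comp Θ = constantCoeff := by
      apply Polynomial.ringHom_ext
      · intro c
        simp [hΘC, hτ]
      · simp [hΘX, hgg, hresπ]
    exact DFunLike.congr_fun this P
  have hΘker : ∀ P, Θ P = 0 ↔ X ^ d ∣ P := by
    intro P
    constructor
    · intro h
      by_cases hP : P = 0
      · rw [hP]; exact dvd_zero _
      obtain ⟨P1, hP1, hP1'⟩ := Polynomial.exists_eq_pow_rootMultiplicity_mul_and_not_dvd P hP 0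
      rw [C_0, sub_zero] at hP1 hP1'
      rw [X_dvd_iff] at hP1'
      set j := rootMultiplicity 0 P
      obtain ⟨y, hy⟩ := hpr (Θ P1)
      have hyu : IsUnit y := by
        by_contra hyu
        apply hP1'
        rw [← hggΘ, ← hy, hgg, hres0, ← Ideal.mem_span_singleton, ← hπ.maximalIdeal_eq]
        exact hyu
      have h2 : pr (π ^ j * y) = 0 := by
        rw [map_mul, map_pow, hy, ← hΘX, ← map_pow, ← map_mul, ← hP1, h]
      rw [hpr0] at h2
      have h3 : π ^ d ∣ π ^ j := by
        exact (hyu.dvd_mul_right).1 h2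
      have h4 : d ≤ j := (pow_dvd_pow_iff hπ.ne_zero hπ.not_isUnit).1 h3
      rw [hP1]
      exact (pow_dvd_pow _ h4).mul_right _
    · rintro ⟨Q, rfl⟩
      rw [map_mul, map_pow, hΘX, hπd, zero_mul]
  choose Xs hXs using fun l => hsurj' (pr (x l))
  refine ⟨κ, inferInstance, inferInstance, d, Xs, fun h => ?_⟩
  rw [← hΘker, hd.dvd_iff_dvd_left, ← hpr0]
  have e1 : pr (MvPolynomial.aeval x h) = MvPolynomial.aeval (fun l => pr (x l)) h :=
    hom_aeval (pr : V →+* W) x h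
  have e2 : ∀ {i : Algebra ℤ κ[X]}, Θ (MvPolynomial.aeval Xs h) =
      MvPolynomial.aeval (fun l => pr (x l)) h := by
    intro i
    have := hom_aeval (iA := i) (iB := inferInstance) Θ Xs h
    simpa only [hXs] using this
  rw [e1, e2]

end

section

open IsLocalRing

/-- Generic ring `ℚ[x, u, 1/u]`. -/
abbrev LL (m : ℕ) : Type := Localization.Away (MvPolynomial.X none : MvPolynomial (Option (Fin m)) ℚ)

/-- The generic coordinates. -/
noncomputable def xx {m : ℕ} (l : Fin m) : LL m :=
  algebraMap (MvPolynomial (Option (Fin m)) ℚ) (LL m) (MvPolynomial.X (some l))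

/-- The generic parameter `u`. -/
noncomputable def uu (m : ℕ) : LL m :=
  algebraMap (MvPolynomial (Option (Fin m)) ℚ) (LL m) (MvPolynomial.X none)

/-- The inverse of the generic parameter. -/
noncomputable def ui (m : ℕ) : LL m :=
  IsLocalization.Away.invSelf (S := LL m) (MvPolynomial.X none : MvPolynomial (Option (Fin m)) ℚ)

theorem uu_mul_ui (m : ℕ) : uu m * ui m = 1 := IsLocalization.Away.mul_invSelf _

/-- The quotients `f / u`. -/
noncomputable def yy {n m : ℕ} (f : Fin n → MvPolynomial (Fin m) ℤ) (i : Fin n) : LL m :=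
  MvPolynomial.aeval xx (f i) * ui m

/-- The extended Rees algebra. -/
noncomputable def RR {n m : ℕ} (f : Fin n → MvPolynomial (Fin m) ℤ) : Subalgebra ℚ (LL m) :=
  Algebra.adjoin ℚ (insert (uu m) (Set.range xx ∪ Set.range (yy f)))

theorem spec_hom {m : ℕ} {E : Type*} [Field E] [CharZero E] (x : Fin m → E) (u : E) (hu : u ≠ 0) :
    ∃ ψ : LL m →+* E, (∀ l, ψ (xx l) = x l) ∧ ψ (uu m) = u ∧
      ∀ {n : ℕ} (f : Fin n → MvPolynomial (Fin m) ℤ) (i : Fin n),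
        ψ (yy f i) = MvPolynomial.aeval x (f i) / u := by
  obtain ⟨φ, hφn, hφs⟩ : ∃ φ : MvPolynomial (Option (Fin m)) ℚ →+* E,
      φ (MvPolynomial.X none) = u ∧ ∀ l, φ (MvPolynomial.X (some l)) = x l :=
    ⟨MvPolynomial.eval₂Hom (algebraMap ℚ E) (fun o : Option (Fin m) => o.elim u x),
      by simp, by simp⟩
  have hun : IsUnit (φ (MvPolynomial.X none)) := by rw [hφn]; exact hu.isUnit
  obtain ⟨ψ, h1⟩ : ∃ ψ : LL m →+* E, ∀ a, ψ (algebraMap _ _ a) = φ a :=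
    ⟨IsLocalization.Away.lift _ hun, fun a => IsLocalization.Away.lift_eq _ hun a⟩
  have hx : ∀ l, ψ (xx l) = x l := fun l => (h1 _).trans (hφs l)
  have hu' : ψ (uu m) = u := (h1 _).trans hφn
  refine ⟨ψ, hx, hu', fun f i => ?_⟩
  rw [yy, map_mul, hom_aeval (iB := inferInstance) ψ xx (f i), eq_div_iff hu, mul_assoc]
  have : ψ (ui m) * u = 1 := by
    rw [← hu', ← map_mul, mul_comm, uu_mul_ui, map_one]
  rw [this, mul_one]
  simp only [hx]

theorem uu_mem {n m : ℕ} (f : Fin n → MvPolynomial (Fin m) ℤ) : uu m ∈ RR f :=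
  Algebra.subset_adjoin (Set.mem_insert _ _)

theorem xx_mem {n m : ℕ} (f : Fin n → MvPolynomial (Fin m) ℤ) (l : Fin m) : xx l ∈ RR f :=
  Algebra.subset_adjoin (Set.mem_insert_of_mem _ (Or.inl ⟨l, rfl⟩))

theorem yy_mem {n m : ℕ} (f : Fin n → MvPolynomial (Fin m) ℤ) (i : Fin n) : yy f i ∈ RR f :=
  Algebra.subset_adjoin (Set.mem_insert_of_mem _ (Or.inr ⟨i, rfl⟩))

/-- Coordinates in the Rees algebra. -/
noncomputable def xr {n m : ℕ} (f : Fin n → MvPolynomial (Fin m) ℤ) (l : Fin m) : RR f :=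
  ⟨xx l, xx_mem f l⟩

/-- The parameter in the Rees algebra. -/
noncomputable def ur {n m : ℕ} (f : Fin n → MvPolynomial (Fin m) ℤ) : RR f :=
  ⟨uu m, uu_mem f⟩

instance LL_domain (m : ℕ) : IsDomain (LL m) :=
  IsLocalization.isDomain_localization (powers_le_nonZeroDivisors_of_noZeroDivisors
    (MvPolynomial.X_ne_zero none))

instance RR_fin {n m : ℕ} (f : Fin n → MvPolynomial (Fin m) ℤ) : Algebra.FiniteType ℚ (RR f) := by
  rw [← Subalgebra.fg_iff_finiteType]
  refine Subalgebra.fg_def.2 ⟨_, ?_, rfl⟩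
  exact ((Set.finite_range _).union (Set.finite_range _)).insert _

theorem uu_ne {m : ℕ} : uu m ≠ 0 := fun h => by
  have := uu_mul_ui m
  rw [h, zero_mul] at this
  exact zero_ne_one this

theorem ur_dvd {n m : ℕ} (f : Fin n → MvPolynomial (Fin m) ℤ) (i : Fin n) :
    ur f ∣ MvPolynomial.aeval (xr f) (f i) := by
  refine ⟨⟨yy f i, yy_mem f i⟩, Subtype.ext ?_⟩
  have h := hom_aeval (iA := inferInstance) (iB := inferInstance) (RR f).val.toRingHom (xr f) (f i)
  have h2 : ((MvPolynomial.aeval (xr f) (f i) : RR f) : LL m) = MvPolynomial.aeval xx (f i) := h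
  rw [h2]
  change _ = uu m * yy f i
  rw [yy, mul_comm, mul_assoc, mul_comm (ui m), uu_mul_ui, mul_one]

open Polynomial in
/-- Existence of an arc. -/
def Arc {n m : ℕ} (f : Fin n → MvPolynomial (Fin m) ℤ) (g : MvPolynomial (Fin m) ℤ) : Prop :=
  ∃ (κ : Type) (_ : Field κ) (_ : CharZero κ) (d : ℕ) (X : Fin m → κ[X]),
      (∀ i, (Polynomial.X : κ[X]) ^ d ∣ MvPolynomial.aeval X (f i)) ∧
      ¬ (Polynomial.X : κ[X]) ^ d ∣ MvPolynomial.aeval X g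

open Polynomial in
/-- An integral relation for `g / u`. -/
def IRel {n m : ℕ} (f : Fin n → MvPolynomial (Fin m) ℤ) (g : MvPolynomial (Fin m) ℤ) : Prop :=
  ∃ q : (RR f)[X], q.Monic ∧ (q.scaleRoots (ur f)).eval (MvPolynomial.aeval (xr f) g) = 0

open Polynomial in
theorem dichotomy {n m : ℕ} (f : Fin n → MvPolynomial (Fin m) ℤ) (g : MvPolynomial (Fin m) ℤ) :
    Arc f g ∨ IRel f g := by
  by_cases hR : IRel f g
  · exact Or.inr hR
  left
  have hb : ur f ≠ 0 := fun h => uu_ne (congrArg Subtype.val h)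
  obtain ⟨V, _, _, _, φ, hφ0, hφ⟩ := exists_dvr_of_not_integral
    (MvPolynomial.aeval (xr f) g) (ur f) hb (fun q hq h => hR ⟨q, hq, h⟩)
  letI : Algebra ℚ V := (φ.comp (algebraMap ℚ (RR f))).toAlgebra
  obtain ⟨κ, i1, i2, d, X, hX⟩ := dvr_coeff (φ (ur f)) hφ0 (fun h => hφ h.dvd)
    (fun l => φ (xr f l))
  refine ⟨κ, i1, i2, d, X, fun i => ?_, ?_⟩
  · rw [← hX, ← hom_aeval φ]
    exact map_dvd φ (ur_dvd f i)
  · rw [← hX, ← hom_aeval φ]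
    exact hφ

open Polynomial in
theorem IRel.spec {n m : ℕ} {f : Fin n → MvPolynomial (Fin m) ℤ} {g : MvPolynomial (Fin m) ℤ}
    {q : (RR f)[X]} (h : (q.scaleRoots (ur f)).eval (MvPolynomial.aeval (xr f) g) = 0)
    {E : Type*} [Field E] (ψ : LL m →+* E) (x : Fin m → E) (u : E) (hx : ∀ l, ψ (xx l) = x l)
    (hu : ψ (uu m) = u) (hu0 : u ≠ 0) :
    (q.map (ψ.comp (RR f).val.toRingHom)).eval (MvPolynomial.aeval x g / u) = 0 := by
  set θ : RR f →+* E := ψ.comp (RR f).val.toRingHom with hθ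
  have hxr : ∀ l, θ (xr f l) = x l := hx
  have hur : θ (ur f) = u := hu
  have h1 : θ (MvPolynomial.aeval (xr f) g) = MvPolynomial.aeval x g := by
    rw [hom_aeval (iB := inferInstance) θ]; simp only [hxr]
  have h2 := scaleRoots_eval₂_mul (p := q) θ (MvPolynomial.aeval x g / u) (ur f)
  rw [hur, mul_div_cancel₀ _ hu0, ← h1, eval₂_at_apply, h, map_zero, eq_comm] at h2
  rw [eval_map, ← h1]
  exact (mul_eq_zero.1 h2).resolve_left (pow_ne_zero _ hu0)

end

theorem v_rat {K : Type*} [Field K] [CharZero K]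
    {Γ₀ : Type*} [LinearOrderedCommGroupWithZero Γ₀]
    (v : Valuation K Γ₀) (hres : ∀ k : ℤ, k ≠ 0 → v (k : K) = 1) (r : ℚ) : v (r : K) ≤ 1 := by
  rw [Rat.cast_def, map_div₀]
  have h1 : v ((r.den : K)) = 1 := by
    simpa using hres r.den (by exact_mod_cast r.den_nz)
  rw [h1, div_one]
  by_cases h : r.num = 0
  · simp [h]
  · exact (hres _ h).le

theorem exists_mid {K : Type*} [Field K]
    {Γ₀ : Type*} [LinearOrderedCommGroupWithZero Γ₀]
    (v : Valuation K Γ₀) (hv : ∃ a : K, v a ≠ 0 ∧ v a < 1) {n : ℕ} (hn : 1 ≤ n)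
    (F : Fin n → K) (G : K) (h : ∀ i, v (F i) < v G) :
    ∃ u : K, u ≠ 0 ∧ (∀ i, v (F i) ≤ v u) ∧ v u < v G := by
  obtain ⟨a, ha0, ha1⟩ := hv
  have : Nonempty (Fin n) := ⟨⟨0, hn⟩⟩
  obtain ⟨i0, hi0⟩ := Finite.exists_max (fun i => v (F i))
  have hG : v G ≠ 0 := (lt_of_le_of_lt zero_le (h i0)).ne'
  by_cases h0 : F i0 = 0
  · have hF : ∀ i, v (F i) = 0 := fun i => by
      have := hi0 i
      rw [h0, map_zero] at this
      exact le_antisymm this zero_le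
    refine ⟨a * G, ?_, fun i => by rw [hF]; exact zero_le, ?_⟩
    · rintro h; apply mul_ne_zero ha0 hG; rw [← map_mul, h, map_zero]
    · rw [map_mul]
      exact mul_lt_of_lt_one_left (zero_lt_iff.2 hG) ha1
  · exact ⟨F i0, h0, hi0, h i0⟩

open Polynomial in
theorem IRel.K_unsolv {n m : ℕ} (hn : 1 ≤ n) {f : Fin n → MvPolynomial (Fin m) ℤ}
    {g : MvPolynomial (Fin m) ℤ} (hR : IRel f g)
    {K : Type*} [Field K] [CharZero K]
    {Γ₀ : Type*} [LinearOrderedCommGroupWithZero Γ₀]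
    (v : Valuation K Γ₀) (hv : ∃ a : K, v a ≠ 0 ∧ v a < 1)
    (hres : ∀ k : ℤ, k ≠ 0 → v (k : K) = 1) (x : Fin m → K) (hx : ∀ l, v (x l) ≤ 1)
    (hlt : ∀ i, v (MvPolynomial.aeval x (f i)) < v (MvPolynomial.aeval x g)) : False := by
  obtain ⟨q, hq, hq0⟩ := hR
  obtain ⟨u, hu0, hu1, hu2⟩ := exists_mid v hv hn _ _ hlt
  have hvu : v u ≠ 0 := (v.ne_zero_iff).2 hu0
  have hu3 : v u ≤ 1 := by
    refine hu2.le.trans ?_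
    have h0 := hom_aeval (iA := inferInstance) (iB := inferInstance) (v.integer.subtype)
      (fun l => (⟨x l, hx l⟩ : v.integer)) g
    have h1 : MvPolynomial.aeval x g = v.integer.subtype (MvPolynomial.aeval
      (fun l => (⟨x l, hx l⟩ : v.integer)) g) := by rw [h0]; rfl
    rw [h1]
    exact Subtype.prop (MvPolynomial.aeval (fun l => (⟨x l, hx l⟩ : v.integer)) g)
  obtain ⟨ψ, h1, h2, h3⟩ := spec_hom x u hu0
  have hmem : ∀ r ∈ RR f, v (ψ r) ≤ 1 := by
    intro r hr
    induction hr using Algebra.adjoin_induction with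
    | mem r hr =>
      rcases hr with rfl | ⟨l, rfl⟩ | ⟨i, rfl⟩
      · rw [h2]; exact hu3
      · rw [h1]; exact hx l
      · rw [h3, map_div₀]
        exact div_le_one_of_le₀ (hu1 i) zero_le
    | algebraMap r =>
      have : ψ (algebraMap ℚ (LL m) r) = (r : K) := map_ratCast (ψ.comp (algebraMap ℚ (LL m))) r
      rw [this]
      exact v_rat v hres r
    | add a b _ _ ha hb => rw [map_add]; exact v.map_add_le ha hb
    | mul a b _ _ ha hb => rw [map_mul, map_mul]; exact mul_le_one' ha hb
  have hs := IRel.spec hq0 ψ x u h1 h2 hu0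
  have hint : IsIntegral v.integer (MvPolynomial.aeval x g / u) := by
    let θ : RR f →+* v.integer :=
      (ψ.comp (RR f).val.toRingHom).codRestrict v.integer (fun r => hmem r r.2)
    refine ⟨q.map θ, hq.map θ, ?_⟩
    rw [eval₂_map]
    rw [eval_map] at hs
    exact hs
  have := (Valuation.integer.integers v).mem_of_integral hint
  have h4 : v (MvPolynomial.aeval x g / u) ≤ 1 := this
  rw [map_div₀, div_le_one₀ (zero_lt_iff.2 hvu)] at h4
  exact absurd hu2 (not_lt.2 h4)

open Polynomial in
/-- An arc along which `f` vanishes to order `d` and `g` has exact order `b < d`. -/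
def GoodArc {n m : ℕ} (A : Type*) [CommRing A] (f : Fin n → MvPolynomial (Fin m) ℤ)
    (g : MvPolynomial (Fin m) ℤ) (d b : ℕ) (X : Fin m → A[X]) : Prop :=
  b < d ∧ (∀ i, (Polynomial.X : A[X]) ^ d ∣ MvPolynomial.aeval X (f i)) ∧
    ∃ w : A[X], MvPolynomial.aeval X g = Polynomial.X ^ b * w ∧ IsUnit (w.coeff 0)

open Polynomial in
theorem GoodArc.map {n m : ℕ} {A B : Type*} [CommRing A] [CommRing B]
    {f : Fin n → MvPolynomial (Fin m) ℤ}
    {g : MvPolynomial (Fin m) ℤ} {d b : ℕ} {X : Fin m → A[X]} (h : GoodArc A f g d b X)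
    (φ : A →+* B) : GoodArc B f g d b (fun l => (X l).map φ) := by
  obtain ⟨h1, h2, w, h3, h4⟩ := h
  have key : ∀ r : MvPolynomial (Fin m) ℤ, MvPolynomial.aeval (fun l => (X l).map φ) r =
      (MvPolynomial.aeval X r).map φ := fun r => by
    have := hom_aeval (iA := inferInstance) (iB := inferInstance) (mapRingHom φ) X r
    exact this.symm
  refine ⟨h1, fun i => ?_, w.map φ, ?_, ?_⟩
  · rw [key]
    obtain ⟨y, hy⟩ := h2 i
    exact ⟨y.map φ, by rw [hy]; simp⟩
  · rw [key, h3]; simp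
  · rw [coeff_map]; exact h4.map φ

open Polynomial in
/-- Descent of good arcs along an injective map whose image contains the coefficients. -/
theorem GoodArc.descend {n m : ℕ} {A B : Type*} [CommRing A] [CommRing B]
    {f : Fin n → MvPolynomial (Fin m) ℤ}
    {g : MvPolynomial (Fin m) ℤ} {d b : ℕ} (φ : A →+* B) (hφ : Function.Injective φ)
    (X : Fin m → A[X]) (h : GoodArc B f g d b (fun l => (X l).map φ))
    (hu : ∀ a : A, φ a = (MvPolynomial.aeval (fun l => (X l).map φ) g).coeff b → IsUnit a) :
    GoodArc A f g d b X := by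
  obtain ⟨h1, h2, w, h3, h4⟩ := h
  have key : ∀ r : MvPolynomial (Fin m) ℤ, MvPolynomial.aeval (fun l => (X l).map φ) r =
      (MvPolynomial.aeval X r).map φ := fun r => by
    have := hom_aeval (iA := inferInstance) (iB := inferInstance) (mapRingHom φ) X r
    exact this.symm
  have hX : (Polynomial.X : A[X]) ^ b ∣ MvPolynomial.aeval X g := by
    rw [X_pow_dvd_iff]
    intro j hj
    apply hφ
    have : (Polynomial.X : B[X]) ^ b ∣ MvPolynomial.aeval (fun l => (X l).map φ) g := ⟨w, h3⟩
    rw [X_pow_dvd_iff] at this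
    rw [← coeff_map, ← key, this j hj, map_zero]
  obtain ⟨w', hw'⟩ := hX
  refine ⟨h1, fun i => ?_, w', hw', ?_⟩
  · rw [X_pow_dvd_iff]
    intro j hj
    apply hφ
    have := h2 i
    rw [X_pow_dvd_iff] at this
    rw [← coeff_map, ← key, this j hj, map_zero]
  · apply hu
    rw [key, hw', coeff_map, coeff_X_pow_mul', if_pos le_rfl, Nat.sub_self]

open Polynomial in
theorem GoodArc.eval {n m : ℕ} {A B : Type*} [CommRing A] [CommRing B]
    {f : Fin n → MvPolynomial (Fin m) ℤ}
    {g : MvPolynomial (Fin m) ℤ} {d b : ℕ} {X : Fin m → A[X]} (h : GoodArc A f g d b X)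
    (φ : A →+* B) (π : B) :
    (∀ i, π ^ d ∣ MvPolynomial.aeval (fun l => (X l).eval₂ φ π) (f i)) ∧
    ∃ c z : B, IsUnit c ∧ 
      MvPolynomial.aeval (fun l => (X l).eval₂ φ π) g = π ^ b * (c + π * z) := by
  obtain ⟨h1, h2, w, h3, h4⟩ := h
  have key : ∀ r : MvPolynomial (Fin m) ℤ, MvPolynomial.aeval (fun l => (X l).eval₂ φ π) r =
      (MvPolynomial.aeval X r).eval₂ φ π := fun r => by
    have := hom_aeval (iA := inferInstance) (iB := inferInstance) (eval₂RingHom φ π) X r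
    exact this.symm
  refine ⟨fun i => ?_, φ (w.coeff 0), w.divX.eval₂ φ π, h4.map φ, ?_⟩
  · rw [key]
    obtain ⟨y, hy⟩ := h2 i
    exact ⟨y.eval₂ φ π, by rw [hy, ← coe_eval₂RingHom, map_mul, map_pow]; simp⟩
  · rw [key, h3, ← coe_eval₂RingHom, map_mul, map_pow]
    congr 1
    · simp
    · conv_lhs => rw [← divX_mul_X_add w]
      simp
      ring

/-- Finite type `ℚ`-algebras have `ℚ̄`-points. -/
theorem exists_hom_qbar (A : Type*) [CommRing A] [Nontrivial A] [Algebra ℚ A]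
    [Algebra.FiniteType ℚ A] : Nonempty (A →+* AlgebraicClosure ℚ) := by
  obtain ⟨M, hM⟩ := Ideal.exists_maximal A
  let : Field (A ⧸ M) := Ideal.Quotient.field M
  have : Algebra.FiniteType ℚ (A ⧸ M) := inferInstance
  have : Module.Finite ℚ (A ⧸ M) := finite_of_finite_type_of_isJacobsonRing ℚ (A ⧸ M)
  have : Algebra.IsAlgebraic ℚ (A ⧸ M) := inferInstance
  exact ⟨(IsAlgClosed.lift (R := ℚ) (S := A ⧸ M) (M := AlgebraicClosure ℚ)).toRingHom.comp
    (Ideal.Quotient.mk M)⟩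

open Polynomial in
theorem lift_polys {A B : Type*} [CommRing A] [CommRing B] (φ : A →+* B) {m : ℕ}
    (X : Fin m → B[X]) (h : ∀ l j, (X l).coeff j ∈ φ.range) :
    ∃ Y : Fin m → A[X], (fun l => (Y l).map φ) = X := by
  have : ∀ l, ∃ y : A[X], y.map φ = X l := fun l => by
    have := (lifts_iff_coeff_lifts (f := φ) (X l)).2 (fun j => h l j)
    exact (mem_lifts _).1 this
  choose Y hY using this
  exact ⟨Y, funext hY⟩

open Polynomial in
/-- The finite set of coefficients needed. -/
theorem coeffs_finite {B : Type*} [CommRing B] {m : ℕ} (X : Fin m → B[X]) (c : B) :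
    (insert c {x | ∃ l j, (X l).coeff j = x}).Finite := by
  apply Set.Finite.insert
  have : {x | ∃ l j, (X l).coeff j = x} = ⋃ l, Set.range (X l).coeff := by
    ext; simp
  rw [this]
  apply Set.finite_iUnion
  intro l
  have := (X l).finite_range_coeff
  exact this

open Polynomial in
theorem Arc.good {n m : ℕ} {f : Fin n → MvPolynomial (Fin m) ℤ}
    {g : MvPolynomial (Fin m) ℤ} (h : Arc f g) : ∃ (d b : ℕ) (X : Fin m → (AlgebraicClosure ℚ)[X]),
      GoodArc (AlgebraicClosure ℚ) f g d b X := by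
  obtain ⟨κ, _, _, d, X, hf, hg⟩ := h
  set G := MvPolynomial.aeval X g with hG
  have hG0 : G ≠ 0 := fun h => hg (by rw [h]; exact dvd_zero _)
  set b := G.natTrailingDegree with hb
  have hbd : b < d := by
    by_contra hlt
    apply hg
    rw [X_pow_dvd_iff]
    intro j hj
    exact coeff_eq_zero_of_lt_natTrailingDegree (by omega)
  have hc : G.coeff b ≠ 0 := by
    have := trailingCoeff_nonzero_iff_nonzero.2 hG0
    exact this
  have hgood : GoodArc κ f g d b X := by
    refine ⟨hbd, fun i => ?_, ?_⟩
    · convert hf i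
    have : (Polynomial.X : κ[X]) ^ b ∣ G := by
      rw [X_pow_dvd_iff]
      intro j hj
      exact coeff_eq_zero_of_lt_natTrailingDegree hj
    obtain ⟨w, hw⟩ := this
    refine ⟨w, ?_, ?_⟩
    · rw [← hw]
    · have := congrArg (fun q => coeff q b) hw
      simp only [coeff_X_pow_mul', if_pos le_rfl, Nat.sub_self] at this
      rw [← this]; exact hc.isUnit
  set S : Set κ := insert (G.coeff b)⁻¹ {x | ∃ l j, (X l).coeff j = x} with hS
  have hSf : S.Finite := coeffs_finite X _
  let A := Algebra.adjoin ℚ S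
  have : Algebra.FiniteType ℚ A := by
    rw [← Subalgebra.fg_iff_finiteType]
    exact Subalgebra.fg_def.2 ⟨S, hSf, rfl⟩
  obtain ⟨ρ⟩ := exists_hom_qbar A
  let φ : A →+* κ := A.val.toRingHom
  obtain ⟨Y, hY⟩ := lift_polys φ X (fun l j => 
    ⟨⟨(X l).coeff j, Algebra.subset_adjoin (Or.inr ⟨l, j, rfl⟩)⟩, rfl⟩)
  have hgA : GoodArc A f g d b Y := by
    refine GoodArc.descend φ Subtype.val_injective Y ?_ ?_
    · rw [hY]; exact hgood
    · intro a ha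
      rw [hY] at ha
      have ha' : (a : κ) = G.coeff b := by
        refine Eq.trans ha ?_
        rw [hG]
      refine IsUnit.of_mul_eq_one ⟨(G.coeff b)⁻¹, Algebra.subset_adjoin (Or.inl rfl)⟩ (Subtype.ext ?_)
      change (a : κ) * (G.coeff b)⁻¹ = 1
      rw [ha', mul_inv_cancel₀ hc]
  exact ⟨d, b, _, hgA.map ρ⟩

instance qbar_alg : Algebra.IsAlgebraic ℚ (AlgebraicClosure ℚ) := by
  have h := AlgebraicClosure.isAlgebraic ℚ
  have e : (DivisionRing.toRatAlgebra : Algebra ℚ (AlgebraicClosure ℚ)) =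
    AlgebraicClosure.instAlgebra ℚ := Subsingleton.elim _ _
  rw [e]
  exact h

open Polynomial in
theorem v_alg {K : Type*} [Field K] [CharZero K]
    {Γ₀ : Type*} [LinearOrderedCommGroupWithZero Γ₀]
    (v : Valuation K Γ₀) (hres : ∀ k : ℤ, k ≠ 0 → v (k : K) = 1) (e : AlgebraicClosure ℚ →+* K)
    (z : AlgebraicClosure ℚ) : v (e z) ≤ 1 := by
  have hz : IsIntegral ℚ z := Algebra.IsIntegral.isIntegral z
  obtain ⟨q, hq, hq0⟩ := hz
  let θ : ℚ →+* v.integer := (algebraMap ℚ K).codRestrict v.integer 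
    (fun r => by
      have := v_rat v hres r
      rw [eq_ratCast]
      exact this)
  have hint : IsIntegral v.integer (e z) := by
    refine ⟨q.map θ, hq.map θ, ?_⟩
    rw [eval₂_map]
    have h1 : (algebraMap v.integer K).comp θ = e.comp (algebraMap ℚ (AlgebraicClosure ℚ)) :=
      RingHom.ext_rat _ _
    rw [h1, ← hom_eval₂, hq0, map_zero]
  exact (Valuation.integer.integers v).mem_of_integral hint

open Polynomial in
theorem K_solv {n m : ℕ} (f g : Fin n → MvPolynomial (Fin m) ℤ) (h : ∀ k, Arc f (g k))
    {K : Type*} [Field K] [IsAlgClosed K] [CharZero K]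
    {Γ₀ : Type*} [LinearOrderedCommGroupWithZero Γ₀]
    (v : Valuation K Γ₀) (hv : ∃ a : K, v a ≠ 0 ∧ v a < 1)
    (hres : ∀ k : ℤ, k ≠ 0 → v (k : K) = 1) :
    ∃ x : Fin n → Fin m → K, (∀ j l, v (x j l) ≤ 1) ∧
            ∀ i j k : Fin n,
              v (MvPolynomial.aeval (x j) (f i)) <
                v (MvPolynomial.aeval (x k) (g k)) := by
  choose d b X hX using fun k => (h k).good
  obtain ⟨a, ha0, ha1⟩ := hv
  let e0 : AlgebraicClosure ℚ →+* K := (IsAlgClosed.lift (R := ℚ) : AlgebraicClosure ℚ →ₐ[ℚ] K).toRingHom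
  let e : AlgebraicClosure ℚ →+* v.integer := e0.codRestrict v.integer (fun z => v_alg v hres e0 z)
  let α : v.integer := ⟨a, ha1.le⟩
  set M := ∏ k, d k with hM
  have hdpos : ∀ k, 0 < d k := fun k => lt_of_le_of_lt (Nat.zero_le _) (hX k).1
  have hdM : ∀ k, d k ∣ M := fun k => Finset.dvd_prod_of_mem d (Finset.mem_univ k)
  have hMpos : 0 < M := Finset.prod_pos (fun k _ => hdpos k)
  let π : Fin n → v.integer := fun k => α ^ (M / d k)
  let x : Fin n → Fin m → v.integer := fun k l => (X k l).eval₂ e (π k)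
  have key : ∀ k (r : MvPolynomial (Fin m) ℤ), MvPolynomial.aeval (fun l => (x k l : K)) r =
     ((MvPolynomial.aeval (x k) r : v.integer) : K) := fun k r => 
      (hom_aeval (iA := inferInstance) (iB := inferInstance) v.integer.subtype (x k) r).symm
  refine ⟨fun k l => (x k l : K), fun j l => (x j l).2, fun i j k => ?_⟩
  have hev := fun k => (hX k).eval e (π k)
  have h1 : v (MvPolynomial.aeval (fun l => (x j l : K)) (f i)) ≤ v a ^ M := by
    rw [key]
    obtain ⟨y, hy⟩ := (hev j).1 i
    have : (MvPolynomial.aeval (x j) (f i) : v.integer) = α ^ M * y := by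
      refine hy.trans ?_
      rw [← pow_mul, Nat.div_mul_cancel (hdM j)]
    rw [this]
    change v (a ^ M * (y : K)) ≤ _
    rw [map_mul, map_pow]
    exact mul_le_of_le_one_right' y.2
  have h2 : v (MvPolynomial.aeval (fun l => (x k l : K)) (g k)) = v a ^ (M / d k * b k) := by
    rw [key]
    obtain ⟨c, z, hc, hy⟩ := (hev k).2
    have : (MvPolynomial.aeval (x k) (g k) : v.integer) = α ^ (M / d k * b k) * (c + π k * z) := by
      refine hy.trans ?_
      rw [← pow_mul]
    rw [this]
    change v (a ^ _ * ((c : K) + (a ^ (M / d k) * z))) = _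
    have hvc : v (c : K) = 1 := by
      obtain ⟨c', hc'⟩ := hc.exists_right_inv
      have h3 : v (c : K) * v (c' : K) = 1 := by
        rw [← map_mul]
        have := congrArg (fun t : v.integer => v (t : K)) hc'
        simpa using this
      refine le_antisymm c.2 ?_
      rw [← h3]
      exact mul_le_of_le_one_right' c'.2
    have hvz : v (a ^ (M / d k) * (z : K)) < v (c : K) := by
      rw [hvc, map_mul, map_pow]
      refine lt_of_le_of_lt (mul_le_of_le_one_right' z.2) ?_
      refine pow_lt_one₀ zero_le ha1 ?_
      exact (Nat.div_pos (Nat.le_of_dvd hMpos (hdM k)) (hdpos k)).ne'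
    rw [map_mul, map_pow, Valuation.map_add_eq_of_lt_left v hvz, hvc, mul_one]
  rw [h2]
  refine lt_of_le_of_lt h1 ?_
  refine pow_lt_pow_right_of_lt_one₀ (zero_lt_iff.2 ha0) ha1 ?_
  calc M / d k * b k < M / d k * d k := by
        refine Nat.mul_lt_mul_of_pos_left (hX k).1 ?_
        exact Nat.div_pos (Nat.le_of_dvd hMpos (hdM k)) (hdpos k)
    _ = M := Nat.div_mul_cancel (hdM k)

theorem Zab.integral {z : AlgebraicClosure ℚ} (hz : z ∈ Zab) : IsIntegral ℤ z := by
  induction hz using Subring.closure_induction with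
  | mem x hx =>
    obtain ⟨n, hn, hx⟩ := hx
    exact IsIntegral.of_pow hn (by rw [hx]; exact isIntegral_one)
  | zero => exact isIntegral_zero
  | one => exact isIntegral_one
  | add x y _ _ hx hy => exact hx.add hy
  | neg x _ hx => exact hx.neg
  | mul x y _ _ hx hy => exact hx.mul hy

theorem Zab.mem_root {x : AlgebraicClosure ℚ} {n : ℕ} (hn : 0 < n) (h : x ^ n = 1) : x ∈ Zab :=
  Subring.subset_closure ⟨n, hn, h⟩

theorem Zab.exists_level {z : AlgebraicClosure ℚ} (hz : z ∈ Zab) :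
    ∃ n : ℕ, 0 < n ∧ ∀ N : ℕ, 0 < N → n ∣ N → ∀ ζ : AlgebraicClosure ℚ, IsPrimitiveRoot ζ N →
      z ∈ Algebra.adjoin ℤ {ζ} := by
  induction hz using Subring.closure_induction with
  | mem x hx =>
    obtain ⟨n, hn, hx⟩ := hx
    refine ⟨n, hn, fun N hN hd ζ hζ => ?_⟩
    have : NeZero N := ⟨hN.ne'⟩
    obtain ⟨i, _, rfl⟩ := hζ.eq_pow_of_pow_eq_one (ξ := x) (by
      obtain ⟨k, rfl⟩ := hd
      rw [pow_mul, hx, one_pow])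
    exact Subalgebra.pow_mem _ (Algebra.self_mem_adjoin_singleton ℤ ζ) i
  | zero => exact ⟨1, one_pos, fun _ _ _ _ _ => zero_mem _⟩
  | one => exact ⟨1, one_pos, fun _ _ _ _ _ => one_mem _⟩
  | add x y _ _ hx hy =>
    obtain ⟨a, ha, hx⟩ := hx
    obtain ⟨b, hb, hy⟩ := hy
    refine ⟨a * b, by positivity, fun N hN hd ζ hζ => ?_⟩
    exact add_mem (hx N hN ((Dvd.intro _ rfl).trans hd) ζ hζ)
      (hy N hN ((Dvd.intro_left _ rfl).trans hd) ζ hζ)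
  | neg x _ hx =>
    obtain ⟨a, ha, hx⟩ := hx
    exact ⟨a, ha, fun N hN hd ζ hζ => neg_mem (hx N hN hd ζ hζ)⟩
  | mul x y _ _ hx hy =>
    obtain ⟨a, ha, hx⟩ := hx
    obtain ⟨b, hb, hy⟩ := hy
    refine ⟨a * b, by positivity, fun N hN hd ζ hζ => ?_⟩
    exact mul_mem (hx N hN ((Dvd.intro _ rfl).trans hd) ζ hζ)
      (hy N hN ((Dvd.intro_left _ rfl).trans hd) ζ hζ)

theorem Zab.exists_prim (n : ℕ) (hn : 0 < n) : ∃ ζ : AlgebraicClosure ℚ, IsPrimitiveRoot ζ n := by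
  have : NeZero n := ⟨hn.ne'⟩
  have : NeZero (n : AlgebraicClosure ℚ) := NeZero.charZero
  exact HasEnoughRootsOfUnity.exists_primitiveRoot _ n

theorem Zab.adjoin_le {n : ℕ} (hn : 0 < n) {ζ : AlgebraicClosure ℚ} (hζ : IsPrimitiveRoot ζ n)
    {z : AlgebraicClosure ℚ} (hz : z ∈ Algebra.adjoin ℤ {ζ}) : z ∈ Zab := by
  induction hz using Algebra.adjoin_induction with
  | mem x hx => rw [Set.mem_singleton_iff.1 hx]; exact Zab.mem_root hn hζ.pow_eq_one
  | algebraMap r => rw [eq_intCast]; exact intCast_mem Zab r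
  | add x y _ _ hx hy => exact add_mem hx hy
  | mul x y _ _ hx hy => exact mul_mem hx hy

theorem Zab.mem_of_integral {z : AlgebraicClosure ℚ} (hz : IsIntegral ℤ z) {d : ℕ} (hd : d ≠ 0)
    (h : (d : AlgebraicClosure ℚ) * z ∈ Zab) : z ∈ Zab := by
  obtain ⟨n, hn, H⟩ := Zab.exists_level h
  obtain ⟨ζ, hζ⟩ := Zab.exists_prim n hn
  have h1 := H n hn dvd_rfl ζ hζ
  have : NeZero n := ⟨hn.ne'⟩
  let L := IntermediateField.adjoin ℚ {ζ}
  have hcyc : IsCyclotomicExtension {n} ℚ L :=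
    hζ.intermediateField_adjoin_isCyclotomicExtension ℚ
  have hζL : ζ ∈ L := IntermediateField.mem_adjoin_simple_self ℚ ζ
  have hdz : (d : AlgebraicClosure ℚ) * z ∈ L := by
    suffices h0 : ∀ w ∈ Algebra.adjoin ℤ {ζ}, w ∈ L from h0 _ h1
    intro w hw
    induction hw using Algebra.adjoin_induction with
    | mem x hx => rw [Set.mem_singleton_iff.1 hx]; exact hζL
    | algebraMap r => rw [eq_intCast]; exact intCast_mem L r
    | add x y _ _ hx hy => exact add_mem hx hy
    | mul x y _ _ hx hy => exact mul_mem hx hy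
  have hzL : z ∈ L := by
    have h2 : (d : AlgebraicClosure ℚ)⁻¹ ∈ L := inv_mem (natCast_mem L d)
    have h3 := mul_mem h2 hdz
    rwa [inv_mul_cancel_left₀ (by exact_mod_cast hd)] at h3
  let ζ' : L := ⟨ζ, hζL⟩
  have hζ' : IsPrimitiveRoot ζ' n := by
    refine IsPrimitiveRoot.of_map_of_injective (f := L.val) ?_ L.val.injective
    exact hζ
  have hcl := IsCyclotomicExtension.Rat.isIntegralClosure_adjoin_singleton hζ'
  have hzi : IsIntegral ℤ (⟨z, hzL⟩ : L) := by
    refine (isIntegral_algHom_iff (L.val.restrictScalars ℤ) L.val.injective).1 ?_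
    exact hz
  obtain ⟨y, hy⟩ := hcl.isIntegral_iff.1 hzi
  have hyz : ((y : L) : AlgebraicClosure ℚ) = z := congrArg Subtype.val hy
  rw [← hyz]
  apply Zab.adjoin_le hn hζ
  have h5 : ∀ w ∈ Algebra.adjoin ℤ {ζ'}, ((w : L) : AlgebraicClosure ℚ) ∈ Algebra.adjoin ℤ {ζ} := by
    intro w hw
    induction hw using Algebra.adjoin_induction with
    | mem x hx => rw [Set.mem_singleton_iff.1 hx]; exact Algebra.subset_adjoin rfl
    | algebraMap r => rw [eq_intCast]; exact intCast_mem _ r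
    | add x y _ _ hx hy => exact add_mem hx hy
    | mul x y _ _ hx hy => exact mul_mem hx hy
  exact h5 _ y.2

theorem RR_denom {n m : ℕ} {f : Fin n → MvPolynomial (Fin m) ℤ} (r : LL m) (hr : r ∈ RR f) :
    ∃ N : ℕ, 0 < N ∧ ∀ ψ : LL m →+* AlgebraicClosure ℚ, ψ (uu m) ∈ Zab → (∀ l, ψ (xx l) ∈ Zab) →
      (∀ i, ψ (yy f i) ∈ Zab) → (N : AlgebraicClosure ℚ) * ψ r ∈ Zab := by
  induction hr using Algebra.adjoin_induction with
  | mem r hr =>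
    refine ⟨1, one_pos, fun ψ h1 h2 h3 => ?_⟩
    rw [Nat.cast_one, one_mul]
    rcases hr with rfl | ⟨l, rfl⟩ | ⟨i, rfl⟩
    · exact h1
    · exact h2 l
    · exact h3 i
  | algebraMap r =>
    refine ⟨r.den, r.den_pos, fun ψ h1 h2 h3 => ?_⟩
    have : ψ (algebraMap ℚ (LL m) r) = (r : AlgebraicClosure ℚ) :=
      map_ratCast (ψ.comp (algebraMap ℚ (LL m))) r
    rw [this, Rat.cast_def, mul_div_cancel₀ _ (by exact_mod_cast r.den_nz)]
    exact intCast_mem Zab _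
  | add a b _ _ ha hb =>
    obtain ⟨N, hN, ha⟩ := ha
    obtain ⟨N', hN', hb⟩ := hb
    refine ⟨N * N', by positivity, fun ψ h1 h2 h3 => ?_⟩
    have e : ((N * N' : ℕ) : AlgebraicClosure ℚ) * ψ (a + b) =
      (N' : AlgebraicClosure ℚ) * (N * ψ a) + N * (N' * ψ b) := by
      rw [map_add]; push_cast; ring
    rw [e]
    exact add_mem (mul_mem (natCast_mem Zab _) (ha ψ h1 h2 h3))
      (mul_mem (natCast_mem Zab _) (hb ψ h1 h2 h3))
  | mul a b _ _ ha hb =>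
    obtain ⟨N, hN, ha⟩ := ha
    obtain ⟨N', hN', hb⟩ := hb
    refine ⟨N * N', by positivity, fun ψ h1 h2 h3 => ?_⟩
    have e : ((N * N' : ℕ) : AlgebraicClosure ℚ) * ψ (a * b) = (N * ψ a) * (N' * ψ b) := by
      rw [map_mul]; push_cast; ring
    rw [e]
    exact mul_mem (ha ψ h1 h2 h3) (hb ψ h1 h2 h3)

open Polynomial in
theorem RR_denom_poly {n m : ℕ} {f : Fin n → MvPolynomial (Fin m) ℤ} (q : (RR f)[X]) :
    ∃ N : ℕ, 0 < N ∧ ∀ ψ : LL m →+* AlgebraicClosure ℚ, ψ (uu m) ∈ Zab → (∀ l, ψ (xx l) ∈ Zab) →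
      (∀ i, ψ (yy f i) ∈ Zab) → ∀ j, (N : AlgebraicClosure ℚ) * ψ (q.coeff j) ∈ Zab := by
  choose N hN h using fun r : RR f => RR_denom r.1 r.2
  refine ⟨∏ j ∈ q.support, N (q.coeff j), Finset.prod_pos (fun j _ => hN _), 
    fun ψ h1 h2 h3 j => ?_⟩
  by_cases hj : j ∈ q.support
  · obtain ⟨k, hk⟩ := Finset.dvd_prod_of_mem (fun j => N (q.coeff j)) hj
    rw [hk, Nat.cast_mul, mul_comm (N _ : AlgebraicClosure ℚ), mul_assoc]
    exact mul_mem (natCast_mem Zab _) (h _ ψ h1 h2 h3)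
  · rw [notMem_support_iff.1 hj]
    simp

open Polynomial in
theorem IRel.T_unsolv {n m : ℕ} {f : Fin n → MvPolynomial (Fin m) ℤ}
    {g : MvPolynomial (Fin m) ℤ} (hR : IRel f g) :
    ∃ N : ℕ, 0 < N ∧ ∀ p : ℕ, p.Prime → ¬ p ∣ N → ∀ x : Fin m → ZabMod p,
      (∀ i, MvPolynomial.aeval x (f i) = 0) → MvPolynomial.aeval x g = 0 := by
  obtain ⟨q, hq, hq0⟩ := hR
  obtain ⟨N, hN, hden⟩ := RR_denom_poly q
  refine ⟨N, hN, fun p hp hpN x hx => ?_⟩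
  choose y hy using fun l => Ideal.Quotient.mk_surjective (I := Ideal.span {(p : Zab)}) (x l)
  have key : ∀ r : MvPolynomial (Fin m) ℤ, MvPolynomial.aeval x r =
     Ideal.Quotient.mk (Ideal.span {(p : Zab)}) (MvPolynomial.aeval y r) := fun r => by
    rw [hom_aeval (iB := inferInstance)]
    simp only [hy]
  have keyv : ∀ (_ : Algebra ℤ (AlgebraicClosure ℚ)) (r : MvPolynomial (Fin m) ℤ), MvPolynomial.aeval (fun l => (y l : AlgebraicClosure ℚ)) r =
     ((MvPolynomial.aeval y r : Zab) : AlgebraicClosure ℚ) := fun _ r =>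
      (hom_aeval (iA := inferInstance) Zab.subtype y r).symm
  have hp0 : (p : AlgebraicClosure ℚ) ≠ 0 := by exact_mod_cast hp.ne_zero
  obtain ⟨ψ, h1, h2, h3⟩ := spec_hom (fun l => (y l : AlgebraicClosure ℚ)) p hp0
  have h3' : ∀ i, ψ (yy f i) ∈ Zab := by
    intro i
    have := hx i
    rw [key, Ideal.Quotient.eq_zero_iff_mem, Ideal.mem_span_singleton] at this
    obtain ⟨z, hz⟩ := this
    rw [h3, keyv, hz]
    push_cast
    rw [mul_div_cancel_left₀ _ hp0]
    exact z.2
  have hden' := hden ψ (by rw [h2]; exact natCast_mem Zab _) (fun l => by rw [h1]; exact (y l).2) h3'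
  have hs := IRel.spec hq0 ψ _ _ h1 h2 hp0
  set G := MvPolynomial.aeval y g with hG
  rw [keyv] at hs
  set Q : (AlgebraicClosure ℚ)[X] := (q.map (ψ.comp (RR f).val.toRingHom)).scaleRoots (N : AlgebraicClosure ℚ) with hQ
  have hQm : Q.Monic := (monic_scaleRoots_iff _).2 (hq.map _)
  have hQ0 : Q.eval ((N : AlgebraicClosure ℚ) * ((G : AlgebraicClosure ℚ) / p)) = 0 := by
    have := scaleRoots_eval₂_mul (p := q.map (ψ.comp (RR f).val.toRingHom))
      (RingHom.id (AlgebraicClosure ℚ)) ((G : AlgebraicClosure ℚ) / p) (N : AlgebraicClosure ℚ)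
    rw [eval₂_id, eval₂_id, hs, mul_zero] at this
    exact this
  have hQc : Q ∈ lifts Zab.subtype := by
    rw [lifts_iff_coeff_lifts]
    intro j
    suffices h : Q.coeff j ∈ Zab from ⟨⟨_, h⟩, rfl⟩
    by_cases hj : j = Q.natDegree
    · rw [hj, hQm.coeff_natDegree]; exact one_mem _
    by_cases hj2 : Q.natDegree < j
    · rw [coeff_eq_zero_of_natDegree_lt hj2]; exact zero_mem _
    have hjlt : j < Q.natDegree := by omega
    rw [hQ, natDegree_scaleRoots] at hjlt
    rw [hQ, coeff_scaleRoots, coeff_map]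
    obtain ⟨k, hk⟩ : ∃ k, (q.map (ψ.comp (RR f).val.toRingHom)).natDegree - j = k + 1 :=
      ⟨_, (Nat.succ_pred_eq_of_pos (Nat.sub_pos_of_lt hjlt)).symm⟩
    rw [hk, pow_succ, mul_comm, mul_assoc]
    exact mul_mem (pow_mem (natCast_mem Zab _) _) (hden' j)
  obtain ⟨Q', hQ', -, hQ'm⟩ := lifts_and_natDegree_eq_and_monic hQc hQm
  have hint : IsIntegral Zab ((N : AlgebraicClosure ℚ) * ((G : AlgebraicClosure ℚ) / p)) := by
    refine ⟨Q', hQ'm, ?_⟩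
    rw [← hQ', eval_map] at hQ0
    exact hQ0
  have hint2 : IsIntegral ℤ ((N : AlgebraicClosure ℚ) * ((G : AlgebraicClosure ℚ) / p)) := by
    have : Algebra.IsIntegral ℤ Zab := ⟨fun z => by
      refine (isIntegral_algHom_iff (Zab.subtype.toIntAlgHom) Subtype.val_injective).1 ?_
      exact Zab.integral z.2⟩
    exact isIntegral_trans _ hint
  have hmem := Zab.mem_of_integral hint2 hp.ne_zero (by
    have : (p : AlgebraicClosure ℚ) * ((N : AlgebraicClosure ℚ) * ((G : AlgebraicClosure ℚ) / p)) =
      N * G := by field_simp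
    rw [this]; exact mul_mem (natCast_mem Zab _) G.2)
  rw [key, Ideal.Quotient.eq_zero_iff_mem, Ideal.mem_span_singleton]
  have hdiv : (p : Zab) ∣ (N : Zab) * G := ⟨⟨_, hmem⟩, Subtype.ext (by
    push_cast; field_simp)⟩
  have hcop : IsCoprime (p : Zab) (N : Zab) := by
    have := (Nat.Coprime.isCoprime ((Nat.Prime.coprime_iff_not_dvd hp).2 hpN))
    have := this.map (Int.castRingHom Zab)
    simpa using this
  exact hcop.dvd_of_dvd_mul_left hdiv

theorem le_totient_aux {n N : ℕ} (hN : 0 < N) (h : N.totient ≤ n) : N ≤ (2 * n).factorial := by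
  apply Nat.le_of_dvd (Nat.factorial_pos _)
  rw [Nat.dvd_iff_prime_pow_dvd_dvd]
  intro p k hp hk
  rcases Nat.eq_zero_or_pos k with rfl | hk0
  · simp
  have h1 : (p ^ k).totient ∣ N.totient := Nat.totient_dvd_of_dvd hk
  have h2 : (p ^ k).totient ≤ n := (Nat.le_of_dvd (Nat.totient_pos.2 hN) h1).trans h
  obtain ⟨j, rfl⟩ : ∃ j, k = j + 1 := ⟨k - 1, by omega⟩
  rw [Nat.totient_prime_pow_succ hp] at h2
  apply Nat.dvd_factorial (pow_pos hp.pos _)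
  have h3 : p ≤ 2 * (p - 1) := by have := hp.two_le; omega
  calc p ^ (j + 1) = p ^ j * p := pow_succ _ _
    _ ≤ p ^ j * (2 * (p - 1)) := Nat.mul_le_mul_left _ h3
    _ = 2 * (p ^ j * (p - 1)) := by ring
    _ ≤ 2 * n := Nat.mul_le_mul_left _ h2

theorem adjoin_denom {S : Set (AlgebraicClosure ℚ)} {N : ℕ}
    (h : ∀ s ∈ S, IsIntegral ℤ ((N : AlgebraicClosure ℚ) * s)) (r : AlgebraicClosure ℚ)
    (hr : r ∈ Algebra.adjoin ℤ S) : ∃ k : ℕ, IsIntegral ℤ ((N : AlgebraicClosure ℚ) ^ k * r) := by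
  have hN : IsIntegral ℤ (N : AlgebraicClosure ℚ) := by
    have := isIntegral_algebraMap (R := ℤ) (A := AlgebraicClosure ℚ) (x := (N : ℤ))
    simpa using this
  induction hr using Algebra.adjoin_induction with
  | mem r hr => exact ⟨1, by rw [pow_one]; exact h r hr⟩
  | algebraMap r => exact ⟨0, by rw [pow_zero, one_mul]; exact isIntegral_algebraMap⟩
  | add x y _ _ hx hy =>
    obtain ⟨k, hx⟩ := hx
    obtain ⟨l, hy⟩ := hy
    refine ⟨k + l, ?_⟩
    have e : (N : AlgebraicClosure ℚ) ^ (k + l) * (x + y) =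
      N ^ l * (N ^ k * x) + N ^ k * (N ^ l * y) := by ring
    rw [e]
    exact ((hN.pow _).mul hx).add ((hN.pow _).mul hy)
  | mul x y _ _ hx hy =>
    obtain ⟨k, hx⟩ := hx
    obtain ⟨l, hy⟩ := hy
    refine ⟨k + l, ?_⟩
    have e : (N : AlgebraicClosure ℚ) ^ (k + l) * (x * y) =
      (N ^ k * x) * (N ^ l * y) := by ring
    rw [e]
    exact hx.mul hy

theorem exists_denom (S : Set (AlgebraicClosure ℚ)) (hS : S.Finite) :
    ∃ N : ℕ, 0 < N ∧ ∀ s ∈ S, IsIntegral ℤ ((N : AlgebraicClosure ℚ) * s) := by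
  have hN : ∀ N : ℕ, IsIntegral ℤ (N : AlgebraicClosure ℚ) := fun N => by
    have := isIntegral_algebraMap (R := ℤ) (A := AlgebraicClosure ℚ) (x := (N : ℤ))
    simpa using this
  induction S, hS using Set.Finite.induction_on with
  | empty => exact ⟨1, one_pos, by simp⟩
  | @insert a S _ _ ih =>
    obtain ⟨N, hN0, ih⟩ := ih
    have ha : IsAlgebraic ℤ a :=
      (IsFractionRing.isAlgebraic_iff ℤ ℚ (AlgebraicClosure ℚ)).2 (Algebra.IsAlgebraic.isAlgebraic a)
    obtain ⟨y, hy0, hy⟩ := ha.exists_integral_multiple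
    refine ⟨N * y.natAbs, Nat.mul_pos hN0 (Int.natAbs_pos.2 hy0), ?_⟩
    have hy' : IsIntegral ℤ ((y.natAbs : AlgebraicClosure ℚ) * a) := by
      rcases Int.natAbs_eq y with h | h
      · rw [h] at hy
        simpa using hy
      · rw [h] at hy
        have := hy.neg
        simpa using this
    rintro s (rfl | hs)
    · push_cast
      rw [mul_assoc]
      exact (hN _).mul hy'
    · push_cast
      rw [mul_comm (N : AlgebraicClosure ℚ), mul_assoc]
      exact (hN _).mul (ih s hs)

theorem not_unit_adjoin {S : Set (AlgebraicClosure ℚ)} {N : ℕ}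
    (h : ∀ s ∈ S, IsIntegral ℤ ((N : AlgebraicClosure ℚ) * s)) {p : ℕ} (hp : p.Prime)
    (hpN : ¬ p ∣ N) : ¬ IsUnit (p : Algebra.adjoin ℤ S) := by
  intro hu
  obtain ⟨r, hr⟩ := hu.exists_right_inv
  obtain ⟨k, hk⟩ := adjoin_denom h r.1 r.2
  have hr' : (p : AlgebraicClosure ℚ) * r.1 = 1 := by
    have := congrArg Subtype.val hr
    simpa using this
  have hp0 : (p : AlgebraicClosure ℚ) ≠ 0 := by exact_mod_cast hp.ne_zero
  have hr2 : r.1 = (p : AlgebraicClosure ℚ)⁻¹ := eq_inv_of_mul_eq_one_right hr'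
  rw [hr2] at hk
  have e : (N : AlgebraicClosure ℚ) ^ k * (p : AlgebraicClosure ℚ)⁻¹ =
    algebraMap ℚ (AlgebraicClosure ℚ) ((N : ℚ) ^ k * (p : ℚ)⁻¹) := by simp
  rw [e, isIntegral_algebraMap_iff (algebraMap ℚ (AlgebraicClosure ℚ)).injective] at hk
  obtain ⟨z, hz⟩ := IsIntegrallyClosed.isIntegral_iff.1 hk
  have hz2 : (z : ℚ) * p = (N : ℚ) ^ k := by
    have h0 : (p : ℚ) ≠ 0 := by exact_mod_cast hp.ne_zero
    have hz' : (z : ℚ) = (N : ℚ) ^ k * (p : ℚ)⁻¹ := by simpa using hz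
    rw [hz']; field_simp
  have hz3 : z * p = (N : ℤ) ^ k := by exact_mod_cast hz2
  have : (p : ℤ) ∣ (N : ℤ) ^ k := ⟨z, by rw [← hz3, mul_comm]⟩
  have : p ∣ N ^ k := by exact_mod_cast this
  exact hpN (hp.dvd_of_dvd_pow this)

open Polynomial in
theorem GoodArc.spread {n m : ℕ} {f : Fin n → MvPolynomial (Fin m) ℤ}
    {g : MvPolynomial (Fin m) ℤ} {d b : ℕ} {X : Fin m → (AlgebraicClosure ℚ)[X]}
    (h : GoodArc (AlgebraicClosure ℚ) f g d b X) : ∃ N : ℕ, 0 < N ∧ ∀ p : ℕ, p.Prime → ¬ p ∣ N →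
      ∃ (F : Type) (_ : Field F) (_ : Finite F) (_ : CharP F p) (Y : Fin m → F[X]),
        GoodArc F f g d b Y := by
  set G := MvPolynomial.aeval X g with hG
  have hc : G.coeff b ≠ 0 := by
    obtain ⟨_, _, w, hw, hu⟩ := h
    have hw' : G = Polynomial.X ^ b * w := hw
    rw [hw', coeff_X_pow_mul', if_pos le_rfl, Nat.sub_self]
    exact hu.ne_zero
  set S : Set (AlgebraicClosure ℚ) := insert (G.coeff b)⁻¹ {x | ∃ l j, (X l).coeff j = x} with hS
  have hSf : S.Finite := coeffs_finite X _
  obtain ⟨N, hN, hden⟩ := exists_denom S hSf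
  refine ⟨N, hN, fun p hp hpN => ?_⟩
  have hnu := not_unit_adjoin hden hp hpN
  let A := Algebra.adjoin ℤ S
  have hft : Algebra.FiniteType ℤ A := by
    rw [← Subalgebra.fg_iff_finiteType]
    exact Subalgebra.fg_def.2 ⟨S, hSf, rfl⟩
  let φ : A →+* AlgebraicClosure ℚ := A.val.toRingHom
  obtain ⟨Y, hY⟩ := lift_polys φ X (fun l j => 
    ⟨⟨(X l).coeff j, Algebra.subset_adjoin (Or.inr ⟨l, j, rfl⟩)⟩, rfl⟩)
  have hgA : GoodArc A f g d b Y := by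
    refine GoodArc.descend φ Subtype.val_injective Y ?_ ?_
    · rw [hY]; exact h
    · intro a ha
      rw [hY] at ha
      have ha' : (a : AlgebraicClosure ℚ) = G.coeff b := ha
      refine IsUnit.of_mul_eq_one ⟨(G.coeff b)⁻¹, Algebra.subset_adjoin (Or.inl rfl)⟩ (Subtype.ext ?_)
      change (a : AlgebraicClosure ℚ) * (G.coeff b)⁻¹ = 1
      rw [ha', mul_inv_cancel₀ hc]
  obtain ⟨M, hM, hpM⟩ := exists_max_ideal_of_mem_nonunits (a := (p : A)) hnu
  let iF : Field (A ⧸ M) := Ideal.Quotient.field M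
  have hp0 : (p : A ⧸ M) = 0 := by
    have := Ideal.Quotient.eq_zero_iff_mem.2 hpM
    simpa using this
  have hchar : CharP (A ⧸ M) p := (CharP.charP_iff_prime_eq_zero hp).2 hp0
  have hfinite : Finite (A ⧸ M) := by
    have : Fact p.Prime := ⟨hp⟩
    let _ : Algebra (ZMod p) (A ⧸ M) := ZMod.algebra (A ⧸ M) p
    have : IsScalarTower ℤ (ZMod p) (A ⧸ M) := inferInstance
    have : Algebra.FiniteType ℤ (A ⧸ M) := inferInstance
    have : Algebra.FiniteType (ZMod p) (A ⧸ M) :=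
      Algebra.FiniteType.of_restrictScalars_finiteType ℤ (ZMod p) _
    have : Module.Finite (ZMod p) (A ⧸ M) :=
      finite_of_finite_type_of_isJacobsonRing (ZMod p) (A ⧸ M)
    exact Module.finite_of_finite (ZMod p)
  exact ⟨A ⧸ M, iF, hfinite, hchar, _, hgA.map (Ideal.Quotient.mk M)⟩

theorem exists_unif (p : ℕ) (hp : p.Prime) (b d : ℕ) (hbd : b < d) :
    ∃ π : ZabMod p, π ^ d = 0 ∧ ∀ P : Ideal Zab, P.IsPrime → (p : Zab) ∈ P → ∀ y : Zab, y ∉ P → 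
      Ideal.Quotient.mk (Ideal.span {(p : Zab)}) y * π ^ b ≠ 0 := by
  have : Fact p.Prime := ⟨hp⟩
  obtain ⟨r, hr⟩ : ∃ r, d * d ≤ (p ^ (r + 1)).totient := by
    refine ⟨d * d, ?_⟩
    rw [Nat.totient_prime_pow_succ hp]
    calc d * d ≤ p ^ (d * d) * 1 := by rw [mul_one]; exact (Nat.lt_pow_self hp.one_lt).le
      _ ≤ _ := Nat.mul_le_mul_left _ (by have := hp.two_le; omega)
  set Φ := (p ^ (r + 1)).totient with hΦ
  obtain ⟨ζ0, hζ0⟩ := Zab.exists_prim (p ^ (r + 1)) (pow_pos hp.pos _)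
  let ζ : Zab := ⟨ζ0, Zab.mem_root (pow_pos hp.pos _) hζ0.pow_eq_one⟩
  have hζ : IsPrimitiveRoot ζ (p ^ (r + 1)) :=
    IsPrimitiveRoot.of_map_of_injective (f := Zab.subtype) hζ0 Subtype.val_injective
  set lam : Zab := ζ - 1 with hlam
  have hassoc : Associated (lam ^ Φ) (p : Zab) := by
    have h1 := Polynomial.eval_one_cyclotomic_prime_pow (R := Zab) (p := p) r
    rw [Polynomial.cyclotomic_eq_prod_X_sub_primitiveRoots hζ, Polynomial.eval_prod] at h1
    rw [← h1, hΦ, ← hζ.card_primitiveRoots, ← Finset.prod_const]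
    apply Associated.prod
    intro μ hμ
    rw [mem_primitiveRoots (pow_pos hp.pos _)] at hμ
    obtain ⟨i, hi, hi2, rfl⟩ := (hζ.isPrimitiveRoot_iff).1 hμ
    have h2 := hζ.associated_sub_one_pow_sub_one_of_coprime hi2
    refine h2.trans ?_
    simp only [Polynomial.eval_sub, Polynomial.eval_X, Polynomial.eval_C]
    rw [← neg_sub]
    exact (Associated.refl _).neg_left
  have hp0 : (p : Zab) ≠ 0 := by
    intro h
    have := congrArg Subtype.val h
    push_cast at this
    exact hp.ne_zero (by exact_mod_cast this)
  have hlam0 : lam ≠ 0 := by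
    intro h
    rw [h, zero_pow (Nat.totient_pos.2 (pow_pos hp.pos _)).ne'] at hassoc
    exact hp0 ((associated_zero_iff_eq_zero _).1 hassoc.symm)
  have hd0 : 0 < d := by omega
  set e := Φ / d + 1 with he
  have hed : Φ ≤ e * d := by
    have := Nat.div_add_mod Φ d
    have := Nat.mod_lt Φ hd0
    rw [he, add_mul]; nlinarith
  have heb : e * b < Φ := by
    have h1 := Nat.div_add_mod Φ d
    have h2 : d ≤ Φ / d := (Nat.le_div_iff_mul_le hd0).2 hr
    rw [he]
    obtain ⟨c, rfl⟩ : ∃ c, d = b + 1 + c := ⟨d - (b + 1), by omega⟩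
    generalize Φ / (b + 1 + c) = k at *
    generalize Φ % (b + 1 + c) = r' at *
    have h4 : (b + 1 + c) * k = k * b + k + k * c := by ring
    have h5 : (k + 1) * b = k * b + b := by ring
    rw [h5]
    rw [h4] at h1
    generalize k * b = u at *
    generalize k * c = w at *
    clear hed he h4 h5 hr
    omega
  refine ⟨Ideal.Quotient.mk _ (lam ^ e), ?_, fun P hP hpP y hy h => ?_⟩
  · rw [← map_pow, Ideal.Quotient.eq_zero_iff_mem, Ideal.mem_span_singleton, ← pow_mul]
    exact hassoc.symm.dvd.trans (pow_dvd_pow _ hed)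
  · rw [← map_pow, ← map_mul, Ideal.Quotient.eq_zero_iff_mem, Ideal.mem_span_singleton, ← pow_mul] at h
    have h1 : lam ^ Φ ∣ y * lam ^ (e * b) := hassoc.dvd.trans h
    obtain ⟨k, hk⟩ : ∃ k, Φ = (k + 1) + e * b := ⟨Φ - e * b - 1, by omega⟩
    rw [hk, pow_add] at h1
    have h2 := (mul_dvd_mul_iff_right (pow_ne_zero _ hlam0)).1 h1
    apply hy
    have hlP : lam ∈ P := by
      apply hP.mem_of_pow_mem Φ
      exact P.mem_of_dvd hassoc.symm.dvd hpP
    exact P.mem_of_dvd ((dvd_pow_self _ (Nat.succ_ne_zero k)).trans h2) hlP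

open Polynomial in
theorem exists_hom_field {p : ℕ} [Fact p.Prime] (F L : Type) [Field F] [Finite F] [CharP F p]
    [Field L] [CharP L p]
    (h : (X ^ (Nat.card F - 1) - 1 : L[X]).Splits) : Nonempty (F →+* L) := by
  let _ : Algebra (ZMod p) F := ZMod.algebra F p
  let _ : Algebra (ZMod p) L := ZMod.algebra L p
  have hs : ((X ^ Nat.card F - X : (ZMod p)[X]).map (algebraMap (ZMod p) L)).Splits := by
    have hq : 1 < Nat.card F := Finite.one_lt_card
    have e : (X ^ Nat.card F - X : (ZMod p)[X]).map (algebraMap (ZMod p) L) =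
      X * (X ^ (Nat.card F - 1) - 1) := by
      obtain ⟨k, hk⟩ : ∃ k, Nat.card F = k + 1 := ⟨Nat.card F - 1, by omega⟩
      rw [hk]
      simp
      ring
    rw [e]
    exact Splits.X.mul h
  have hne : ((X ^ Nat.card F - X : (ZMod p)[X]).map (algebraMap (ZMod p) L)) ≠ 0 := by
    rw [Polynomial.map_ne_zero_iff (algebraMap (ZMod p) L).injective]
    exact FiniteField.X_pow_card_sub_X_ne_zero _ Finite.one_lt_card
  have : Nonempty (F →ₐ[ZMod p] L) := by
    apply IntermediateField.nonempty_algHom_of_splits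
    intro s
    refine ⟨Algebra.IsIntegral.isIntegral s, hs.of_dvd hne ?_⟩
    apply Polynomial.map_dvd
    apply minpoly.dvd
    have : Fintype F := Fintype.ofFinite F
    simp [FiniteField.pow_card, Nat.card_eq_fintype_card]
  obtain ⟨φ⟩ := this
  exact ⟨φ.toRingHom⟩

open Polynomial in
theorem exists_section_aux {p : ℕ} (hp : p.Prime) (F : Type) [Field F] [Finite F] [CharP F p]
    (A R : Type) [CommRing A] [IsDomain A] [CommRing R] [Nontrivial R] [Module.Finite ℤ R]
    (hp0 : (p : R) = 0) (θ0 : A →+* R) (ζA : A) (hζA : IsPrimitiveRoot ζA (Nat.card F - 1))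
    (hpow : ∀ y : R, y ^ Nat.card F = y) : Nonempty (F →+* R) := by
  have : Fact p.Prime := ⟨hp⟩
  have hq1 : 1 < Nat.card F := Finite.one_lt_card
  have hchar : CharP R p := (CharP.charP_iff_prime_eq_zero hp).2 hp0
  have hfinite : Finite R := by
    let _ : Algebra (ZMod p) R := ZMod.algebra R p
    have : IsScalarTower ℤ (ZMod p) R := inferInstance
    have : Module.Finite (ZMod p) R := Module.Finite.of_restrictScalars_finite ℤ (ZMod p) _
    exact Module.finite_of_finite (ZMod p)
  have hred : IsReduced R := by
    rw [isReduced_iff_pow_one_lt _ hq1]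
    intro y hy
    rw [← hpow y, hy]
  have hsec : ∀ M : MaximalSpectrum R, Nonempty (F →+* R ⧸ M.asIdeal) := by
    intro M
    have hM := M.isMaximal
    let _ : Field (R ⧸ M.asIdeal) := Ideal.Quotient.field M.asIdeal
    have hp1 : (p : R ⧸ M.asIdeal) = 0 := by
      rw [← map_natCast (Ideal.Quotient.mk M.asIdeal), hp0, map_zero]
    have : CharP (R ⧸ M.asIdeal) p := (CharP.charP_iff_prime_eq_zero hp).2 hp1
    apply exists_hom_field (p := p)
    let θ : A →+* R ⧸ M.asIdeal := (Ideal.Quotient.mk M.asIdeal).comp θ0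
    have h1 := congrArg (Polynomial.map θ) (X_pow_sub_one_eq_prod (by omega) hζA)
    rw [Polynomial.map_prod] at h1
    have h2 : (X ^ (Nat.card F - 1) - 1 : A[X]).map θ = X ^ (Nat.card F - 1) - 1 := by simp
    rw [h2] at h1
    rw [h1]
    apply Splits.prod
    intro i _
    rw [Polynomial.map_sub, map_X, map_C]
    exact Splits.X_sub_C _
  let s := fun M => (hsec M).some
  have : IsArtinianRing R := inferInstance
  exact ⟨(IsArtinianRing.equivPi R).symm.toRingEquiv.toRingHom.comp (Pi.ringHom s)⟩

theorem pow_card_aux {p q r : ℕ} (hp : p.Prime) (hr : q = p ^ r) (R : Type) [CommRing R]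
    [CharP R p] (z : R) (hz : z ^ q = z) (y : R) (hy : y ∈ Algebra.adjoin ℤ {z}) :
    y ^ q = y := by
  have : Fact p.Prime := ⟨hp⟩
  induction hy using Algebra.adjoin_induction with
  | mem x hx =>
    have hx' : x = z := hx
    rw [hx', hz]
  | algebraMap r' =>
    have h2 : ((r' : ZMod p) ^ q) = r' := by rw [hr, ZMod.pow_card_pow]
    have h3 := congrArg (ZMod.castHom dvd_rfl R) h2
    simpa using h3
  | add x y hx hy ihx ihy =>
    rw [hr, add_pow_char_pow, ← hr, ihx, ihy]
  | mul x y hx hy ihx ihy =>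
    rw [mul_pow, ihx, ihy]

theorem exists_section_aux2 {p : ℕ} (hp : p.Prime) (F : Type) [Field F] [Finite F] [CharP F p]
    (A R : Type) [CommRing A] [IsDomain A] [CommRing R]
    (hp0 : (p : R) = 0) (θ0 : A →+* R) (ζA : A) (hζA : IsPrimitiveRoot ζA (Nat.card F - 1))
    (hint : IsIntegral ℤ ζA) : Nonempty (F →+* R) := by
  rcases subsingleton_or_nontrivial R with hsub | hnon
  · exact ⟨{ toFun := fun _ => 0, map_one' := Subsingleton.elim _ _, map_mul' := fun _ _ => Subsingleton.elim _ _, map_zero' := rfl, map_add' := fun _ _ => Subsingleton.elim _ _ }⟩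
  have : Fact p.Prime := ⟨hp⟩
  have hq1 : 1 < Nat.card F := Finite.one_lt_card
  obtain ⟨r, hr⟩ : ∃ r, Nat.card F = p ^ r := by
    have : Fintype F := Fintype.ofFinite F
    obtain ⟨r, -, hr⟩ := FiniteField.card F p
    exact ⟨r, by rw [Nat.card_eq_fintype_card, hr]⟩
  have hchar : CharP R p := (CharP.charP_iff_prime_eq_zero hp).2 hp0
  let z : R := θ0 ζA
  have hzint : IsIntegral ℤ z := hint.map θ0.toIntAlgHom
  let R' := Algebra.adjoin ℤ {z}
  have hfin : Module.Finite ℤ R' := Module.Finite.iff_fg.2 hzint.fg_adjoin_singleton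
  have hzq : z ^ Nat.card F = z := by
    obtain ⟨k, hk⟩ : ∃ k, Nat.card F = k + 1 := ⟨Nat.card F - 1, by omega⟩
    have h1 : z ^ (Nat.card F - 1) = 1 := by
      rw [← map_pow, hζA.pow_eq_one, map_one]
    rw [hk, Nat.add_sub_cancel] at h1
    rw [hk, pow_succ, h1, one_mul]
  let A' := Algebra.adjoin ℤ {ζA}
  let ζ' : A' := ⟨ζA, Algebra.self_mem_adjoin_singleton ℤ ζA⟩
  have hζ' : IsPrimitiveRoot ζ' (Nat.card F - 1) :=
    IsPrimitiveRoot.of_map_of_injective (f := A'.val) hζA Subtype.val_injective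
  have hmem : ∀ a : A', (θ0.toIntAlgHom.comp A'.val) a ∈ R' := by
    intro a
    have h2 : Subalgebra.map θ0.toIntAlgHom A' = R' := by
      have := AlgHom.map_adjoin θ0.toIntAlgHom {ζA}
      rw [Set.image_singleton] at this
      exact this
    rw [← h2]
    exact ⟨a, a.2, rfl⟩
  obtain ⟨φ⟩ := exists_section_aux hp F A' R' (by
      apply Subtype.ext; push_cast; exact hp0)
    ((θ0.toIntAlgHom.comp A'.val).codRestrict R' hmem).toRingHom ζ' hζ' (by
      intro y
      apply Subtype.ext
      exact pow_card_aux hp hr R z hzq y y.2)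
  exact ⟨R'.val.toRingHom.comp φ⟩

theorem ZabMod.p_zero (p : ℕ) : (p : ZabMod p) = 0 := by
  rw [← map_natCast (Ideal.Quotient.mk (Ideal.span {(p : Zab)}))]
  exact Ideal.Quotient.eq_zero_iff_mem.2 (Ideal.mem_span_singleton_self _)

theorem Zab.exists_prim' (n : ℕ) (hn : 0 < n) :
    ∃ ζ : Zab, IsPrimitiveRoot ζ n ∧ IsIntegral ℤ ζ := by
  obtain ⟨ζ0, hζ0⟩ := Zab.exists_prim n hn
  refine ⟨⟨ζ0, Zab.mem_root hn hζ0.pow_eq_one⟩,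
    IsPrimitiveRoot.of_map_of_injective (f := Zab.subtype) hζ0 Subtype.val_injective, ?_⟩
  refine (isIntegral_algHom_iff (Zab.subtype.toIntAlgHom) Subtype.val_injective).1 ?_
  exact Zab.integral (Zab.mem_root hn hζ0.pow_eq_one)

theorem exists_section {p : ℕ} (hp : p.Prime) (F : Type) [Field F] [Finite F] [CharP F p] :
    Nonempty (F →+* ZabMod p) := by
  have hq1 : 1 < Nat.card F := Finite.one_lt_card
  obtain ⟨ζ, hζ, hi⟩ := Zab.exists_prim' (Nat.card F - 1) (by omega)
  exact exists_section_aux2 hp F Zab (ZabMod p) (ZabMod.p_zero p)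
    (Ideal.Quotient.mk (Ideal.span {(p : Zab)})) ζ hζ hi

open Polynomial in
theorem exists_prime_aux {p N : ℕ} (hp : p.Prime) (hN : 0 < N) (S K : Type) [CommRing S]
    [IsDomain S] [Algebra.IsIntegral ℤ S] [Field K] [CharZero K] (ι : S →+* K)
    (hι : Function.Injective ι) (ζ : S) (hζ : IsPrimitiveRoot ζ N) (c : ℤ)
    (hc : IsPrimitiveRoot (c : ZMod p) N) :
    ∃ P : Ideal S, P.IsPrime ∧ (p : S) ∈ P ∧ ζ - (c : S) ∈ P := by
  have : Fact p.Prime := ⟨hp⟩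
  let alg : Algebra ℤ[X] S := (aeval (R := ℤ) ζ).toRingHom.toAlgebra
  have hal : ∀ h : ℤ[X], algebraMap ℤ[X] S h = aeval ζ h := fun h => rfl
  have tow : IsScalarTower ℤ ℤ[X] S := by
    apply IsScalarTower.of_algebraMap_eq
    intro x
    rw [hal]
    simp
  have hint : Algebra.IsIntegral ℤ[X] S := Algebra.IsIntegral.tower_top ℤ
  let ev : ℤ[X] →+* ZMod p := eval₂RingHom (Int.castRingHom (ZMod p)) (c : ZMod p)
  have hPr : (RingHom.ker ev).IsPrime := RingHom.ker_isPrime ev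
  obtain ⟨Q, hQ, hcomap⟩ := Ideal.exists_ideal_over_prime_of_isIntegral_of_isDomain
    (R := ℤ[X]) (S := S) (RingHom.ker ev) (by
      intro h hh
      have h0 : aeval ζ h = 0 := hh
      have h1 : aeval (ι ζ) h = 0 := by
        have := congrArg ι.toIntAlgHom h0
        rw [map_zero, ← aeval_algHom_apply] at this
        exact this
      have hζK : IsPrimitiveRoot (ι ζ) N := hζ.map_of_injective hι
      have hd : cyclotomic N ℤ ∣ h := by
        rw [cyclotomic_eq_minpoly hζK hN]
        exact minpoly.isIntegrallyClosed_dvd (hζK.isIntegral hN) h1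
      obtain ⟨w, rfl⟩ := hd
      rw [RingHom.mem_ker, map_mul]
      have hN0 : NeZero N := ⟨hN.ne'⟩
      have hNe : NeZero (N : ZMod p) := hc.neZero'
      have h2 : ev (cyclotomic N ℤ) = 0 := by
        have := (isRoot_cyclotomic_iff (R := ZMod p) (n := N)).2 hc
        rw [← map_cyclotomic_int, IsRoot.def, eval_map] at this
        exact this
      rw [h2, zero_mul])
  refine ⟨Q, hQ, ?_, ?_⟩
  · have : (p : ℤ[X]) ∈ Q.comap (algebraMap ℤ[X] S) := by
      rw [hcomap, RingHom.mem_ker, map_natCast]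
      simp
    rw [Ideal.mem_comap, map_natCast] at this
    exact this
  · have : (X - C c : ℤ[X]) ∈ Q.comap (algebraMap ℤ[X] S) := by
      rw [hcomap, RingHom.mem_ker]
      simp [ev]
    rw [Ideal.mem_comap, hal] at this
    simpa using this

theorem idem_aux {p n : ℕ} (hp : p.Prime) (T : Type) [CommRing T] (hpT : (p : T) = 0) (z : T)
    (hz : z ^ p = z) (c : Fin n → ℤ) (hc : Function.Injective fun k => (c k : ZMod p)) :
    OrthogonalIdempotents (fun k => 1 - (z - (c k : T)) ^ (p - 1)) := by
  have : Fact p.Prime := ⟨hp⟩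
  rcases subsingleton_or_nontrivial T with hsub | hnon
  · exact ⟨fun _ => Subsingleton.elim _ _, fun _ _ _ => Subsingleton.elim _ _⟩
  have hchar : CharP T p := (CharP.charP_iff_prime_eq_zero hp).2 hpT
  have ht : ∀ k, (z - (c k : T)) * (1 - (z - (c k : T)) ^ (p - 1)) = 0 := by
    intro k
    have h2 : (((c k : ℤ) : ZMod p) ^ p) = (c k : ℤ) := ZMod.pow_card _
    have h3 := congrArg (ZMod.castHom dvd_rfl T) h2
    have h4 : ((c k : ℤ) : T) ^ p = (c k : ℤ) := by
      rw [map_pow, map_intCast] at h3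
      exact h3
    have h5 : (z - (c k : T)) ^ p = z - (c k : T) := by
      rw [sub_pow_char, hz, h4]
    obtain ⟨r, rfl⟩ : ∃ r, p = r + 1 := ⟨p - 1, by have := hp.pos; omega⟩
    rw [Nat.add_sub_cancel, mul_sub, mul_one, ← pow_succ', h5, sub_self]
  constructor
  · intro k
    obtain ⟨r, hr⟩ : ∃ r, p - 1 = r + 1 := ⟨p - 2, by have := hp.two_le; omega⟩
    have h := ht k
    rw [hr] at h
    show (1 - (z - (c k : T)) ^ (p - 1)) * (1 - (z - (c k : T)) ^ (p - 1)) = _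
    rw [hr]
    linear_combination -(z - (c k : T)) ^ r * h
  · intro k l hkl
    show (1 - (z - (c k : T)) ^ (p - 1)) * (1 - (z - (c l : T)) ^ (p - 1)) = 0
    have hu : IsUnit ((c l : T) - (c k : T)) := by
      have h1 : (c l : ZMod p) - (c k : ZMod p) ≠ 0 := by
        rw [sub_ne_zero]
        exact fun h => hkl (hc h.symm)
      have := h1.isUnit.map (ZMod.castHom dvd_rfl T)
      simpa using this
    refine (hu.mul_right_eq_zero).1 ?_
    linear_combination (1 - (z - (c l : T)) ^ (p - 1)) * ht k
      - (1 - (z - (c k : T)) ^ (p - 1)) * ht l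

theorem ZabMod.exists_idems {p n : ℕ} (hp : p.Prime) (hn : n ≤ (p - 1).totient) :
    ∃ e : Fin n → ZabMod p, OrthogonalIdempotents e ∧ ∀ k, ∃ P : Ideal Zab, P.IsPrime ∧
      (p : Zab) ∈ P ∧ ∃ y ∉ P, Ideal.Quotient.mk (Ideal.span {(p : Zab)}) y = e k := by
  have : Fact p.Prime := ⟨hp⟩
  have hp1 : 0 < p - 1 := by have := hp.two_le; omega
  obtain ⟨ζ, hζ, -⟩ := Zab.exists_prim' (p - 1) hp1
  obtain ⟨c0, hc0⟩ : ∃ c : ZMod p, IsPrimitiveRoot c (p - 1) := by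
    obtain ⟨u, hu⟩ := IsCyclic.exists_generator (α := (ZMod p)ˣ)
    refine ⟨u, ?_⟩
    rw [IsPrimitiveRoot.coe_units_iff]
    have := orderOf_eq_card_of_forall_mem_zpowers hu
    rw [Nat.card_eq_fintype_card, ZMod.card_units] at this
    rw [← this]
    exact IsPrimitiveRoot.orderOf u
  have hcard := hc0.card_primitiveRoots
  obtain ⟨j⟩ : Nonempty (Fin n ↪ primitiveRoots (p - 1) (ZMod p)) := by
    apply Function.Embedding.nonempty_of_card_le
    simpa [hcard] using hn
  let c : Fin n → ℤ := fun k => ((j k : ZMod p).val : ℤ)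
  have hcj : ∀ k, (c k : ZMod p) = j k := by
    intro k
    simp [c]
  have hcp : ∀ k, IsPrimitiveRoot (c k : ZMod p) (p - 1) := by
    intro k
    rw [hcj]
    exact (mem_primitiveRoots hp1).1 (j k).2
  let mk := Ideal.Quotient.mk (Ideal.span {(p : Zab)})
  have hz : (mk ζ) ^ p = mk ζ := by
    rw [← map_pow]
    congr 1
    have h := hζ.pow_eq_one
    obtain ⟨r, hr⟩ : ∃ r, p = r + 1 := ⟨p - 1, by omega⟩
    rw [hr, Nat.add_sub_cancel] at h
    rw [hr, pow_succ, h, one_mul]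
  refine ⟨_, idem_aux hp (ZabMod p) (ZabMod.p_zero p) (mk ζ) hz c ?_, ?_⟩
  · intro k l hkl
    simp only [hcj] at hkl
    exact j.injective (Subtype.ext hkl)
  · intro k
    have hint : Algebra.IsIntegral ℤ Zab := ⟨fun z => by
      refine (isIntegral_algHom_iff (Zab.subtype.toIntAlgHom) Subtype.val_injective).1 ?_
      exact Zab.integral z.2⟩
    obtain ⟨P, hP, hpP, hcP⟩ := exists_prime_aux hp hp1 Zab (AlgebraicClosure ℚ) Zab.subtype
      Subtype.val_injective ζ hζ (c k) (hcp k)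
    refine ⟨P, hP, hpP, 1 - (ζ - (c k : Zab)) ^ (p - 1), ?_, ?_⟩
    · intro h
      have h2 := P.add_mem h (P.pow_mem_of_mem hcP (p - 1) hp1)
      rw [sub_add_cancel] at h2
      exact hP.ne_top ((Ideal.eq_top_iff_one _).2 h2)
    · rw [map_sub, map_one, map_pow, map_sub, map_intCast]

theorem aeval_inst {m : ℕ} {T : Type} [CommRing T] (iA iB : Algebra ℤ T) (x : Fin m → T)
    (h : MvPolynomial (Fin m) ℤ) :
    (letI := iA; MvPolynomial.aeval x h) = (letI := iB; MvPolynomial.aeval x h) := by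
  have : iA = iB := Subsingleton.elim _ _
  subst this
  rfl

theorem glue_aux {m n : ℕ} (T : Type) [CommRing T] {iT : Algebra ℤ T} (e : Option (Fin n) → T)
    (he : CompleteOrthogonalIdempotents e) (x : Option (Fin n) → Fin m → T) :
    ∃ y : Fin m → T, ∀ (h : MvPolynomial (Fin m) ℤ) (o),
      e o * MvPolynomial.aeval y h = e o * MvPolynomial.aeval (x o) h := by
  refine ⟨fun l => ∑ o, e o * x o l, ?_⟩
  intro h o
  let I : Ideal T := (Ideal.span {1 - e o})
  have key : ∀ a b : T, Ideal.Quotient.mk I a = Ideal.Quotient.mk I b → e o * a = e o * b := by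
    intro a b hab
    rw [Ideal.Quotient.eq] at hab
    obtain ⟨c, hc⟩ := Ideal.mem_span_singleton.1 hab
    have h1 : e o * e o = e o := he.idem o
    linear_combination e o * hc - c * h1
  apply key
  rw [hom_aeval (iA := iT) (iB := inferInstance),
    hom_aeval (iA := iT) (iB := inferInstance)]
  congr 2
  funext l
  rw [Ideal.Quotient.eq]
  apply Ideal.mem_span_singleton.2
  refine ⟨∑ o', e o' * x o' l - x o l, ?_⟩
  have h2 : e o * ∑ o', e o' * x o' l = e o * x o l := by
    rw [Finset.mul_sum, Finset.sum_eq_single o]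
    · rw [← mul_assoc, he.idem o]
    · intro b _ hb
      rw [← mul_assoc, he.ortho hb.symm, zero_mul]
    · simp
  linear_combination h2

theorem T_solv_one {n m : ℕ} {f : Fin n → MvPolynomial (Fin m) ℤ} {g : MvPolynomial (Fin m) ℤ}
    (h : Arc f g) : ∃ N : ℕ, 0 < N ∧ ∀ p : ℕ, p.Prime → ¬ p ∣ N → ∃ x : Fin m → ZabMod p,
      (∀ i, MvPolynomial.aeval x (f i) = 0) ∧
      ∀ P : Ideal Zab, P.IsPrime → (p : Zab) ∈ P → ∀ y ∉ P,
        Ideal.Quotient.mk (Ideal.span {(p : Zab)}) y * MvPolynomial.aeval x g ≠ 0 := by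
  obtain ⟨d, b, X, hX⟩ := h.good
  obtain ⟨N, hN, hs⟩ := hX.spread
  refine ⟨N, hN, ?_⟩
  intro p hp hpN
  obtain ⟨F, iF, iFin, iC, Y, hY⟩ := hs p hp hpN
  obtain ⟨σ⟩ := exists_section hp F
  obtain ⟨π, hπ, hne⟩ := exists_unif p hp b d hX.1
  obtain ⟨h1, c, z, hc, h2⟩ := hY.eval σ π
  refine ⟨fun l => (Y l).eval₂ σ π, ?_, ?_⟩
  · intro i
    have := h1 i
    rw [hπ, zero_dvd_iff] at this
    exact (aeval_inst _ _ _ _).trans this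
  · intro P hP hpP y hy h0
    apply hne P hP hpP y hy
    have hu : IsUnit (c + π * z) := by
      apply IsNilpotent.isUnit_add_left_of_commute _ hc (Commute.all _ _)
      exact ⟨d, by rw [mul_pow, hπ, zero_mul]⟩
    have h3 : MvPolynomial.aeval (fun l => (Y l).eval₂ σ π) g = π ^ b * (c + π * z) :=
      (aeval_inst _ _ _ _).trans h2
    rw [h3, ← mul_assoc] at h0
    exact (hu.mul_left_eq_zero).1 h0

theorem T_solv {n m : ℕ} {f g : Fin n → MvPolynomial (Fin m) ℤ} (hn : 1 ≤ n)
    (h : ∀ k, Arc f (g k)) : ∃ B : ℕ, ∀ p : ℕ, p.Prime → B < p →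
      ∃ x : Fin m → ZabMod p, ∀ i : Fin n,
            MvPolynomial.aeval x (f i) = 0 ∧ MvPolynomial.aeval x (g i) ≠ 0 := by
  choose N hN hx using fun k => T_solv_one (h k)
  refine ⟨(∏ k, N k) + (2 * n).factorial + 1, ?_⟩
  intro p hp hB
  have hpN : ∀ k, ¬ p ∣ N k := by
    intro k hk
    have h1 : p ∣ ∏ k, N k := hk.trans (Finset.dvd_prod_of_mem _ (Finset.mem_univ k))
    have := Nat.le_of_dvd (Finset.prod_pos fun k _ => hN k) h1
    omega
  choose x hf hg using fun k => hx k p hp (hpN k)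
  obtain ⟨e, he, heP⟩ := ZabMod.exists_idems (p := p) (n := n) hp (by
    by_contra hcon
    have := le_totient_aux (N := p - 1) (n := n) (by omega) (by omega)
    omega)
  have hco := CompleteOrthogonalIdempotents.option he
  let k0 : Fin n := ⟨0, hn⟩
  obtain ⟨y, hy⟩ := glue_aux (ZabMod p) _ hco (fun o => Option.elim o (x k0) x)
  refine ⟨y, fun i => ⟨?_, ?_⟩⟩
  · rw [← one_mul (MvPolynomial.aeval y (f i)), ← hco.complete, Finset.sum_mul]
    apply Finset.sum_eq_zero
    intro o _
    rw [hy]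
    rcases o with _ | k
    · simp only [Option.elim]
      rw [hf, mul_zero]
    · simp only [Option.elim]
      rw [hf, mul_zero]
  · intro h0
    have h1 := hy (g i) (some i)
    rw [h0, mul_zero] at h1
    obtain ⟨P, hP, hpP, w, hw, hwe⟩ := heP i
    apply hg i P hP hpP w hw
    rw [hwe]
    exact h1.symm

theorem main_aux (n m : ℕ) (hn : 1 ≤ n)
    (f g : Fin n → MvPolynomial (Fin m) ℤ)
    (K : Type*) [Field K] [IsAlgClosed K] [CharZero K]
    (Γ₀ : Type*) [LinearOrderedCommGroupWithZero Γ₀]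
    (v : Valuation K Γ₀) (hv : ∃ a : K, v a ≠ 0 ∧ v a ≠ 1)
    (hres : ∀ k : ℤ, k ≠ 0 → v (k : K) = 1) :
    {p : ℕ | p.Prime ∧
      ¬ ((∃ x : Fin m → ZabMod p, ∀ i : Fin n,
            MvPolynomial.aeval x (f i) = 0 ∧ MvPolynomial.aeval x (g i) ≠ 0) ↔
        (∃ x : Fin n → Fin m → K, (∀ j l, v (x j l) ≤ 1) ∧
            ∀ i j k : Fin n,
              v (MvPolynomial.aeval (x j) (f i)) <
                v (MvPolynomial.aeval (x k) (g k))))}.Finite := by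
  have hv' : ∃ a, v a ≠ 0 ∧ v a < 1 := by
    obtain ⟨a, h0, h1⟩ := hv
    rcases lt_or_gt_of_ne h1 with h | h
    · exact ⟨a, h0, h⟩
    · refine ⟨a⁻¹, ?_, ?_⟩
      · rw [map_inv₀]
        exact inv_ne_zero h0
      · rw [map_inv₀]
        exact inv_lt_one_of_one_lt₀ h
  by_cases h : ∀ k, Arc f (g k)
  · obtain ⟨B, hB⟩ := T_solv hn h
    refine (Set.finite_Iic B).subset ?_
    rintro p ⟨hp, hne⟩
    by_contra hlt
    exact hne (iff_of_true (hB p hp (not_le.1 hlt)) (K_solv f g h v hv' hres))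
  · push Not at h
    obtain ⟨k, hk⟩ := h
    have hR := (dichotomy f (g k)).resolve_left hk
    obtain ⟨N, hN, hT⟩ := hR.T_unsolv
    refine (Set.finite_Iic N).subset ?_
    rintro p ⟨hp, hne⟩
    refine Nat.le_of_dvd hN ?_
    by_contra hpN
    refine hne (iff_of_false ?_ ?_)
    · rintro ⟨x, hx⟩
      exact (hx k).2 (hT p hp hpN x fun i => (hx i).1)
    · rintro ⟨x, hx, hlt⟩
      exact hR.K_unsolv hn v hv' hres (x k) (hx k) fun i => hlt i k k

/-- Fix `n, m ≥ 1` and integer polynomials `f i, g i`. Let `K` be any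
algebraically closed field of characteristic `0` with a nontrivial valuation `v` for which
`v k = 1` for every nonzero integer `k` (residue characteristic `0`). Then for all but
finitely many primes `p`, the system `f i = 0, g i ≠ 0` is solvable in `ℤ^ab/pℤ^ab` iff
there are tuples `x 1, …, x n` over the valuation ring with
`v (f i (x j)) < v (g k (x k))` for all `i, j, k`. -/
theorem stmt1 (n m : ℕ) (hn : 1 ≤ n) (hm : 1 ≤ m)
    (f g : Fin n → MvPolynomial (Fin m) ℤ)
    (K : Type*) [Field K] [IsAlgClosed K] [CharZero K]
    (Γ₀ : Type*) [LinearOrderedCommGroupWithZero Γ₀]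
    (v : Valuation K Γ₀) (hv : ∃ a : K, v a ≠ 0 ∧ v a ≠ 1)
    (hres : ∀ k : ℤ, k ≠ 0 → v (k : K) = 1) :
    {p : ℕ | p.Prime ∧
      ¬ ((∃ x : Fin m → ZabMod p, ∀ i : Fin n,
            MvPolynomial.aeval x (f i) = 0 ∧ MvPolynomial.aeval x (g i) ≠ 0) ↔
        (∃ x : Fin n → Fin m → K, (∀ j l, v (x j l) ≤ 1) ∧
            ∀ i j k : Fin n,
              v (MvPolynomial.aeval (x j) (f i)) <
                v (MvPolynomial.aeval (x k) (g k))))}.Finite := by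
  exact main_aux n m hn f g K Γ₀ v hv hres

end
end
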